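/- arXiv:cs/0703078 — 6 statements merged into one kernel-verified Lean document; each statement's English description precedes it below -/
import Mathlib

section
/- Achievability part of the capacity theorem for the bidirectional broadcast channel: let W : 𝒳 → PMF(𝒴₁ × 𝒴₂) be a discrete memoryless broadcast channel and suppose the pair (R₂, R₁) of nonnegative reals belongs to the information region 𝒞 of W. Then for every δ > 0 and every ε > 0 there exist n ∈ ℕ, integers M₁, M₂ ≥ 1, and an (M₁, M₂, n)-code whose rates satisfy (log M₁)/n ≥ R₂ − δ and (log M₂)/n ≥ R₁ − δ and whose maximum error probabilities satisfy λ₁⁽ⁿ⁾ ≤ ε and λ₂⁽ⁿ⁾ ≤ ε. -/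
open scoped Classical BigOperators

noncomputable section

namespace BDBC

/-- A `(M₁, M₂, n)`-code for the bidirectional broadcast channel: an encoder at the
relay node and a decoder at each of the two receiving nodes (which know their own
message as side information); `none` plays the role of an erasure symbol. -/
structure Code (𝒳 𝒴₁ 𝒴₂ : Type) (M₁ M₂ n : ℕ) where
  enc : Fin M₁ × Fin M₂ → Fin n → 𝒳
  dec₁ : (Fin n → 𝒴₁) × Fin M₁ → Option (Fin M₂)
  dec₂ : (Fin n → 𝒴₂) × Fin M₂ → Option (Fin M₁)

variable {𝒳 𝒴₁ 𝒴₂ : Type}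

/-- Probability of the event `E` under the `n`-fold memoryless extension of the
broadcast channel `W` with input word `x`. -/
def prodProb [Fintype 𝒴₁] [Fintype 𝒴₂] (W : 𝒳 → PMF (𝒴₁ × 𝒴₂)) {n : ℕ}
    (x : Fin n → 𝒳) (E : (Fin n → 𝒴₁ × 𝒴₂) → Prop) : ℝ :=
  ∑ y ∈ Finset.univ.filter E, ∏ i, ((W (x i)) (y i)).toReal

/-- Error probability `λ₁(w₁,w₂)` at node 1 (which knows `w₁` and decodes `w₂`). -/
def err₁ [Fintype 𝒴₁] [Fintype 𝒴₂] (W : 𝒳 → PMF (𝒴₁ × 𝒴₂)) {M₁ M₂ n : ℕ}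
    (c : Code 𝒳 𝒴₁ 𝒴₂ M₁ M₂ n) (v : Fin M₁ × Fin M₂) : ℝ :=
  prodProb W (c.enc v) (fun y => c.dec₁ (fun i => (y i).1, v.1) ≠ some v.2)

/-- Error probability `λ₂(w₁,w₂)` at node 2 (which knows `w₂` and decodes `w₁`). -/
def err₂ [Fintype 𝒴₁] [Fintype 𝒴₂] (W : 𝒳 → PMF (𝒴₁ × 𝒴₂)) {M₁ M₂ n : ℕ}
    (c : Code 𝒳 𝒴₁ 𝒴₂ M₁ M₂ n) (v : Fin M₁ × Fin M₂) : ℝ :=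
  prodProb W (c.enc v) (fun y => c.dec₂ (fun i => (y i).2, v.2) ≠ some v.1)

/-- Maximum error probability at node `k`. -/
def maxErr₁ [Fintype 𝒴₁] [Fintype 𝒴₂] (W : 𝒳 → PMF (𝒴₁ × 𝒴₂)) {M₁ M₂ n : ℕ}
    (c : Code 𝒳 𝒴₁ 𝒴₂ M₁ M₂ n) : ℝ :=
  ⨆ v : Fin M₁ × Fin M₂, err₁ W c v

def maxErr₂ [Fintype 𝒴₁] [Fintype 𝒴₂] (W : 𝒳 → PMF (𝒴₁ × 𝒴₂)) {M₁ M₂ n : ℕ}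
    (c : Code 𝒳 𝒴₁ 𝒴₂ M₁ M₂ n) : ℝ :=
  ⨆ v : Fin M₁ × Fin M₂, err₂ W c v

/-- Average error probability at node `k`. -/
def avgErr₁ [Fintype 𝒴₁] [Fintype 𝒴₂] (W : 𝒳 → PMF (𝒴₁ × 𝒴₂)) {M₁ M₂ n : ℕ}
    (c : Code 𝒳 𝒴₁ 𝒴₂ M₁ M₂ n) : ℝ :=
  (∑ v : Fin M₁ × Fin M₂, err₁ W c v) / (M₁ * M₂)

def avgErr₂ [Fintype 𝒴₁] [Fintype 𝒴₂] (W : 𝒳 → PMF (𝒴₁ × 𝒴₂)) {M₁ M₂ n : ℕ}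
    (c : Code 𝒳 𝒴₁ 𝒴₂ M₁ M₂ n) : ℝ :=
  (∑ v : Fin M₁ × Fin M₂, err₂ W c v) / (M₁ * M₂)

/-- Shannon entropy (in nats) of a PMF on a finite type. -/
def pmfEntropy {α : Type} [Fintype α] (p : PMF α) : ℝ :=
  ∑ a : α, Real.negMulLog (p a).toReal

/-- Conditional mutual information `I(X;Y|U)` (in nats) computed from the joint law of
`(U, X, Y)` via `I(X;Y|U) = H(U,X) + H(U,Y) - H(U) - H(U,X,Y)`. -/
def condMI {U 𝒳' Y : Type} [Fintype U] [Fintype 𝒳'] [Fintype Y]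
    (p : PMF (U × 𝒳' × Y)) : ℝ :=
  pmfEntropy (p.map fun z => (z.1, z.2.1)) + pmfEntropy (p.map fun z => (z.1, z.2.2))
    - pmfEntropy (p.map Prod.fst) - pmfEntropy p

/-- Joint law of `(U, X, Y₁)` obtained by sampling `(u,x)` from `q` and `(y₁,y₂)` from `W x`. -/
def joint₁ {U : Type} (W : 𝒳 → PMF (𝒴₁ × 𝒴₂)) (q : PMF (U × 𝒳)) : PMF (U × 𝒳 × 𝒴₁) :=
  q.bind fun ux => (W ux.2).map fun y => (ux.1, ux.2, y.1)

/-- Joint law of `(U, X, Y₂)`. -/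
def joint₂ {U : Type} (W : 𝒳 → PMF (𝒴₁ × 𝒴₂)) (q : PMF (U × 𝒳)) : PMF (U × 𝒳 × 𝒴₂) :=
  q.bind fun ux => (W ux.2).map fun y => (ux.1, ux.2, y.2)

/-- The information region `𝒞` of the bidirectional broadcast channel `W`: pairs
`(R₂, R₁)` of nonnegative reals with `R₂ ≤ I(X;Y₂|U)` and `R₁ ≤ I(X;Y₁|U)` for some
finite auxiliary type `U` and input distribution `q` on `U × 𝒳`. -/
def infoRegion [Fintype 𝒳] [Fintype 𝒴₁] [Fintype 𝒴₂] (W : 𝒳 → PMF (𝒴₁ × 𝒴₂)) :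
    Set (ℝ × ℝ) :=
  {R | 0 ≤ R.1 ∧ 0 ≤ R.2 ∧
    ∃ (U : Type) (iU : Fintype U) (q : PMF (U × 𝒳)),
      haveI := iU
      R.1 ≤ condMI (joint₂ W q) ∧ R.2 ≤ condMI (joint₁ W q)}

/-- If `log φ` has negative mean under `p`, then the `n`-fold product of `φ` exceeds `1` with
exponentially small probability under the `n`-fold product of `p`. -/
theorem exists_pow_bound_of_sum_mul_log_neg {α : Type} [Fintype α] (p φ : α → ℝ)
    (hp : ∀ a, 0 ≤ p a) (hp1 : ∑ a, p a = 1) (hφ : ∀ a, p a ≠ 0 → 0 < φ a)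
    (hneg : ∑ a, p a * Real.log (φ a) < 0) :
    ∃ r : ℝ, 0 ≤ r ∧ r < 1 ∧ ∀ n : ℕ,
      ∑ a : Fin n → α, (if 1 < ∏ i, φ (a i) then ∏ i, p (a i) else 0) ≤ r ^ n := by
  have hder : HasDerivAt (fun s : ℝ => ∑ a, p a * Real.exp (s * Real.log (φ a)))
      (∑ a, p a * Real.log (φ a)) 0 := by
    have h : ∀ a ∈ (Finset.univ : Finset α),
        HasDerivAt (fun s : ℝ => p a * Real.exp (s * Real.log (φ a)))
          (p a * Real.log (φ a)) 0 := by
      intro a _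
      have := (((hasDerivAt_id (0 : ℝ)).mul_const (Real.log (φ a))).exp).const_mul (p a)
      simpa using this
    exact HasDerivAt.fun_sum h
  obtain ⟨s, hs, hlt⟩ : ∃ s : ℝ, 0 < s ∧ ∑ a, p a * Real.exp (s * Real.log (φ a)) < 1 := by
    have hev := (hder.hasDerivWithinAt (s := Set.Ioi 0)).limsup_slope_le' (by simp) hneg
    obtain ⟨s, hs, hs0⟩ := (hev.and self_mem_nhdsWithin).exists
    have hs0 : 0 < s := hs0
    refine ⟨s, hs0, ?_⟩
    rw [slope_def_field] at hs
    simp only [zero_mul, Real.exp_zero, mul_one, hp1, sub_zero] at hs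
    rw [div_lt_iff₀ hs0] at hs
    linarith
  refine ⟨∑ a, p a * Real.exp (s * Real.log (φ a)),
    Finset.sum_nonneg fun a _ => mul_nonneg (hp a) (Real.exp_pos _).le, hlt, fun n => ?_⟩
  have hpow : (∑ a, p a * Real.exp (s * Real.log (φ a))) ^ n
      = ∑ a : Fin n → α, ∏ i, (p (a i) * Real.exp (s * Real.log (φ (a i)))) := by
    rw [← Fintype.piFinset_univ, ← Finset.prod_univ_sum (fun _ => Finset.univ)
      fun _ a => p a * Real.exp (s * Real.log (φ a))]
    simp
  rw [hpow]
  refine Finset.sum_le_sum fun a _ => ?_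
  have hnn : 0 ≤ ∏ i, p (a i) := Finset.prod_nonneg fun i _ => hp _
  split_ifs with h
  · rcases hnn.eq_or_lt with h0 | h0
    · rw [← h0]
      exact Finset.prod_nonneg fun i _ => mul_nonneg (hp _) (Real.exp_pos _).le
    · have hpos : ∀ i, 0 < φ (a i) := fun i =>
        hφ _ ((Finset.prod_ne_zero_iff.1 h0.ne') i (Finset.mem_univ _))
      rw [Finset.prod_mul_distrib, ← Real.exp_sum, ← Finset.mul_sum,
        ← Real.log_prod fun i _ => (hpos i).ne']
      exact le_mul_of_one_le_right hnn (Real.one_le_exp (mul_nonneg hs.le (Real.log_pos h).le))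
  · exact Finset.prod_nonneg fun i _ => mul_nonneg (hp _) (Real.exp_pos _).le

theorem toReal_map_apply {α β : Type} [Fintype α] (p : PMF α) (f : α → β) (b : β) :
    ((p.map f) b).toReal = ∑ a, if f a = b then (p a).toReal else 0 := by
  rw [PMF.map_apply, tsum_fintype, ENNReal.toReal_sum]
  · refine Finset.sum_congr rfl fun a _ => ?_
    by_cases h : f a = b
    · simp [h]
    · simp [h, Ne.symm h]
  · intro a _
    split_ifs
    · exact p.apply_ne_top a
    · simp

theorem sum_toReal_eq_one {α : Type} [Fintype α] (p : PMF α) : ∑ a, (p a).toReal = 1 := by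
  rw [← ENNReal.toReal_sum fun a _ => p.apply_ne_top a, ← tsum_fintype (L := .unconditional _),
    p.tsum_coe, ENNReal.toReal_one]

theorem pmfEntropy_map {α β : Type} [Fintype α] [Fintype β] (p : PMF α) (f : α → β) :
    pmfEntropy (p.map f) = -∑ a, (p a).toReal * Real.log ((p.map f) (f a)).toReal := by
  have h : ∀ b, Real.negMulLog ((p.map f) b).toReal
      = -∑ a, if f a = b then (p a).toReal * Real.log ((p.map f) (f a)).toReal else 0 := by
    intro b
    rw [Real.negMulLog, neg_mul, neg_inj]
    conv_lhs => rw [toReal_map_apply p f b]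
    rw [← toReal_map_apply p f b, toReal_map_apply p f b, Finset.sum_mul]
    refine Finset.sum_congr rfl fun a _ => ?_
    split_ifs with hab
    · rw [hab, toReal_map_apply p f b]
    · simp
  rw [pmfEntropy, Finset.sum_congr rfl fun b _ => h b, Finset.sum_neg_distrib, Finset.sum_comm]
  simp

/-- Joint law of `(U, X, Y)` when `(U, X)` is drawn from `q` and `Y` from `V X`. -/
def jointLaw {U X Y : Type} (q : PMF (U × X)) (V : X → PMF Y) : PMF (U × X × Y) :=
  q.bind fun ux => (V ux.2).map fun y => (ux.1, ux.2, y)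

/-- Marginal probability of the auxiliary letter `u`. -/
def auxProb {U X : Type} [Fintype X] (q : PMF (U × X)) (u : U) : ℝ :=
  ∑ x, (q (u, x)).toReal

/-- Joint probability of the auxiliary letter `u` and the output letter `y`. -/
def auxOutProb {U X Y : Type} [Fintype X] (q : PMF (U × X)) (V : X → PMF Y) (u : U) (y : Y) : ℝ :=
  ∑ x, (q (u, x)).toReal * (V x y).toReal

theorem toReal_jointLaw {U X Y : Type} [Fintype U] [Fintype X] [Fintype Y]
    (q : PMF (U × X)) (V : X → PMF Y) (u : U) (x : X) (y : Y) :
    (jointLaw q V (u, x, y)).toReal = (q (u, x)).toReal * (V x y).toReal := by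
  have h : jointLaw q V (u, x, y) = q (u, x) * V x y := by
    rw [jointLaw, PMF.bind_apply, tsum_eq_single (u, x)]
    · rw [PMF.map_apply, tsum_eq_single y]
      · simp
      · intro y' hy'
        simp [Ne.symm hy']
    · rintro ⟨u', x'⟩ hux
      rw [PMF.map_apply, ENNReal.tsum_eq_zero.2, mul_zero]
      intro y'
      rw [if_neg]
      simp only [Prod.mk.injEq, not_and]
      intro h1 h2
      exact absurd (by rw [h1, h2]) hux
  rw [h, ENNReal.toReal_mul]

theorem toReal_jointLaw_map_input {U X Y : Type} [Fintype U] [Fintype X] [Fintype Y]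
    (q : PMF (U × X)) (V : X → PMF Y) (u : U) (x : X) :
    (((jointLaw q V).map fun z => (z.1, z.2.1)) (u, x)).toReal = (q (u, x)).toReal := by
  simp only [toReal_map_apply, Fintype.sum_prod_type, toReal_jointLaw, Prod.mk.injEq, ite_and]
  simp [Finset.sum_ite_irrel, ← Finset.mul_sum, sum_toReal_eq_one]

theorem toReal_jointLaw_map_output {U X Y : Type} [Fintype U] [Fintype X] [Fintype Y]
    (q : PMF (U × X)) (V : X → PMF Y) (u : U) (y : Y) :
    (((jointLaw q V).map fun z => (z.1, z.2.2)) (u, y)).toReal = auxOutProb q V u y := by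
  simp only [toReal_map_apply, Fintype.sum_prod_type, toReal_jointLaw, Prod.mk.injEq, ite_and]
  simp [Finset.sum_ite_irrel, auxOutProb]

theorem toReal_jointLaw_map_fst {U X Y : Type} [Fintype U] [Fintype X] [Fintype Y]
    (q : PMF (U × X)) (V : X → PMF Y) (u : U) :
    (((jointLaw q V).map Prod.fst) u).toReal = auxProb q u := by
  simp only [toReal_map_apply, Fintype.sum_prod_type, toReal_jointLaw]
  simp [Finset.sum_ite_irrel, auxProb, ← Finset.mul_sum, sum_toReal_eq_one]

theorem auxProb_pos {U X : Type} [Fintype X] (q : PMF (U × X)) {u : U} {x : X}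
    (h : 0 < (q (u, x)).toReal) : 0 < auxProb q u :=
  Finset.sum_pos' (fun _ _ => ENNReal.toReal_nonneg) ⟨x, Finset.mem_univ _, h⟩

theorem auxOutProb_nonneg {U X Y : Type} [Fintype X] (q : PMF (U × X)) (V : X → PMF Y)
    (u : U) (y : Y) : 0 ≤ auxOutProb q V u y :=
  Finset.sum_nonneg fun _ _ => mul_nonneg ENNReal.toReal_nonneg ENNReal.toReal_nonneg

theorem auxOutProb_pos {U X Y : Type} [Fintype X] (q : PMF (U × X)) (V : X → PMF Y)
    {u : U} {x : X} {y : Y} (hx : 0 < (q (u, x)).toReal) (hy : 0 < (V x y).toReal) :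
    0 < auxOutProb q V u y :=
  Finset.sum_pos' (fun _ _ => mul_nonneg ENNReal.toReal_nonneg ENNReal.toReal_nonneg)
    ⟨x, Finset.mem_univ _, mul_pos hx hy⟩

/-- The conditional mutual information of `jointLaw` is the mean information density. -/
theorem condMI_jointLaw {U X Y : Type} [Fintype U] [Fintype X] [Fintype Y]
    (q : PMF (U × X)) (V : X → PMF Y) :
    condMI (jointLaw q V) = -∑ z : U × X × Y, (jointLaw q V z).toReal *
      Real.log (auxOutProb q V z.1 z.2.2 / ((V z.2.1 z.2.2).toReal * auxProb q z.1)) := by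
  have hid : pmfEntropy (jointLaw q V)
      = -∑ z, (jointLaw q V z).toReal * Real.log (jointLaw q V z).toReal := by
    simp [pmfEntropy, Real.negMulLog]
  rw [condMI, pmfEntropy_map, pmfEntropy_map, pmfEntropy_map, hid, ← sub_eq_zero]
  simp only [← Finset.sum_neg_distrib, ← Finset.sum_add_distrib, ← Finset.sum_sub_distrib]
  refine Finset.sum_eq_zero ?_
  rintro ⟨u, x, y⟩ -
  simp only [toReal_jointLaw_map_input, toReal_jointLaw_map_output, toReal_jointLaw_map_fst,
    toReal_jointLaw]
  rcases (ENNReal.toReal_nonneg (a := q (u, x))).eq_or_lt with h | h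
  · simp [← h]
  rcases (ENNReal.toReal_nonneg (a := V x y)).eq_or_lt with h' | h'
  · simp [← h']
  have h1 := auxProb_pos q h
  have h2 := auxOutProb_pos q V h h'
  rw [Real.log_div h2.ne' (mul_pos h' h1).ne', Real.log_mul h'.ne' h1.ne',
    Real.log_mul h.ne' h'.ne']
  ring

/-- Output words whose information density with `x` given `u` is at least `γ` per letter. -/
def decodingSet {U X Y : Type} [Fintype X] [Fintype Y] (q : PMF (U × X)) (V : X → PMF Y) (γ : ℝ)
    {n : ℕ} (u : Fin n → U) (x : Fin n → X) : Finset (Fin n → Y) :=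
  Finset.univ.filter fun y => Real.exp (n * γ) * ∏ i, auxOutProb q V (u i) (y i)
    ≤ (∏ i, (V (x i) (y i)).toReal) * ∏ i, auxProb q (u i)

theorem sum_fun_prod {n : ℕ} {α β : Type} [Fintype α] [Fintype β] (f : (Fin n → α × β) → ℝ) :
    ∑ z, f z = ∑ a : Fin n → α, ∑ b : Fin n → β, f fun i => (a i, b i) := by
  rw [← (Equiv.arrowProdEquivProdArrow (Fin n) (fun _ => α) (fun _ => β)).symm.sum_comp,
    Fintype.sum_prod_type]
  rfl

/-- Below the conditional mutual information, the transmitted word's decoding set is missed with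
exponentially small probability. -/
theorem exists_pow_bound_compl_decodingSet {U X Y : Type} [Fintype U] [Fintype X] [Fintype Y]
    (q : PMF (U × X)) (V : X → PMF Y) {γ : ℝ} (hγ : γ < condMI (jointLaw q V)) :
    ∃ r : ℝ, 0 ≤ r ∧ r < 1 ∧ ∀ n : ℕ,
      ∑ u : Fin n → U, ∑ x : Fin n → X, (∏ i, (q (u i, x i)).toReal) *
        ∑ y ∈ (decodingSet q V γ u x)ᶜ, ∏ i, (V (x i) (y i)).toReal ≤ r ^ n := by
  have hpos : ∀ z, (jointLaw q V z).toReal ≠ 0 →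
      0 < (q (z.1, z.2.1)).toReal ∧ 0 < (V z.2.1 z.2.2).toReal := by
    rintro ⟨u, x, y⟩ h
    rw [toReal_jointLaw] at h
    exact ⟨ENNReal.toReal_nonneg.lt_of_ne' (left_ne_zero_of_mul h),
      ENNReal.toReal_nonneg.lt_of_ne' (right_ne_zero_of_mul h)⟩
  obtain ⟨r, hr0, hr1, hr⟩ := exists_pow_bound_of_sum_mul_log_neg
    (fun z => (jointLaw q V z).toReal)
    (fun z => Real.exp γ *
      (auxOutProb q V z.1 z.2.2 / ((V z.2.1 z.2.2).toReal * auxProb q z.1)))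
    (fun _ => ENNReal.toReal_nonneg) (sum_toReal_eq_one _)
    (fun z hz => by
      obtain ⟨h, h'⟩ := hpos z hz
      exact mul_pos (Real.exp_pos _)
        (div_pos (auxOutProb_pos q V h h') (mul_pos h' (auxProb_pos q h))))
    (by
      have hterm : ∀ z, (jointLaw q V z).toReal * Real.log (Real.exp γ *
          (auxOutProb q V z.1 z.2.2 / ((V z.2.1 z.2.2).toReal * auxProb q z.1)))
          = (jointLaw q V z).toReal * γ + (jointLaw q V z).toReal * Real.log
            (auxOutProb q V z.1 z.2.2 / ((V z.2.1 z.2.2).toReal * auxProb q z.1)) := by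
        intro z
        by_cases hz : (jointLaw q V z).toReal = 0
        · simp [hz]
        obtain ⟨h, h'⟩ := hpos z hz
        rw [Real.log_mul (Real.exp_pos _).ne' (div_pos (auxOutProb_pos q V h h')
          (mul_pos h' (auxProb_pos q h))).ne', Real.log_exp]
        ring
      rw [condMI_jointLaw] at hγ
      rw [Finset.sum_congr rfl fun z _ => hterm z, Finset.sum_add_distrib, ← Finset.sum_mul,
        sum_toReal_eq_one]
      linarith)
  refine ⟨r, hr0, hr1, fun n => le_trans (le_of_eq ?_) (hr n)⟩
  rw [sum_fun_prod]
  refine Finset.sum_congr rfl fun u _ => ?_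
  rw [sum_fun_prod]
  refine Finset.sum_congr rfl fun x _ => ?_
  rw [Finset.mul_sum, decodingSet, Finset.compl_filter, Finset.sum_filter]
  refine Finset.sum_congr rfl fun y _ => ?_
  simp only [toReal_jointLaw, Finset.prod_mul_distrib, Finset.prod_div_distrib, Finset.prod_const,
    Finset.card_univ, Fintype.card_fin, ← Real.exp_nat_mul]
  by_cases h0 : (∏ i, (q (u i, x i)).toReal) * ∏ i, (V (x i) (y i)).toReal = 0
  · simp [h0]
  have hq : ∀ i, 0 < (q (u i, x i)).toReal := fun i => ENNReal.toReal_nonneg.lt_of_ne'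
    (Finset.prod_ne_zero_iff.1 (left_ne_zero_of_mul h0) i (Finset.mem_univ _))
  have hV : ∀ i, 0 < (V (x i) (y i)).toReal := fun i => ENNReal.toReal_nonneg.lt_of_ne'
    (Finset.prod_ne_zero_iff.1 (right_ne_zero_of_mul h0) i (Finset.mem_univ _))
  refine if_congr ?_ rfl rfl
  rw [not_le, ← mul_div_assoc, one_lt_div]
  exact mul_pos (Finset.prod_pos fun i _ => hV i)
    (Finset.prod_pos fun i _ => auxProb_pos q (hq i))

theorem sum_prod_input {U X : Type} [Fintype X] (q : PMF (U × X)) {n : ℕ} (u : Fin n → U) :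
    ∑ x : Fin n → X, ∏ i, (q (u i, x i)).toReal = ∏ i, auxProb q (u i) := by
  simp only [auxProb]
  rw [Finset.prod_univ_sum, Fintype.piFinset_univ]

theorem sum_prod_auxProb {U X : Type} [Fintype U] [Fintype X] (q : PMF (U × X)) (n : ℕ) :
    ∑ u : Fin n → U, ∏ i, auxProb q (u i) = 1 := by
  rw [← Fintype.piFinset_univ, ← Finset.prod_univ_sum]
  have : ∑ u, auxProb q u = 1 := by
    rw [← sum_toReal_eq_one q, Fintype.sum_prod_type]
    rfl
  simp [this]

theorem sum_prod_input_mul_output {U X Y : Type} [Fintype X] (q : PMF (U × X))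
    (V : X → PMF Y) {n : ℕ} (u : Fin n → U) (y : Fin n → Y) :
    ∑ x : Fin n → X, (∏ i, (q (u i, x i)).toReal) * ∏ i, (V (x i) (y i)).toReal
      = ∏ i, auxOutProb q V (u i) (y i) := by
  simp only [auxOutProb, ← Finset.prod_mul_distrib]
  rw [Finset.prod_univ_sum, Fintype.piFinset_univ]

theorem sum_decodingSet_le {U X Y : Type} [Fintype X] [Fintype Y] (q : PMF (U × X))
    (V : X → PMF Y) (γ : ℝ) {n : ℕ} (u : Fin n → U) (x : Fin n → X) :
    ∑ y ∈ decodingSet q V γ u x, ∏ i, auxOutProb q V (u i) (y i)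
      ≤ Real.exp (-(n * γ)) * ∏ i, auxProb q (u i) := by
  have hq : 0 ≤ ∏ i, auxProb q (u i) :=
    Finset.prod_nonneg fun i _ => Finset.sum_nonneg fun _ _ => ENNReal.toReal_nonneg
  have hV1 : ∑ y : Fin n → Y, ∏ i, (V (x i) (y i)).toReal = 1 := by
    rw [← Fintype.piFinset_univ,
      ← Finset.prod_univ_sum (fun _ => Finset.univ) fun i y => (V (x i) y).toReal]
    simp [sum_toReal_eq_one]
  have hV : ∑ y ∈ decodingSet q V γ u x, ∏ i, (V (x i) (y i)).toReal ≤ 1 := by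
    rw [← hV1]
    exact Finset.sum_le_sum_of_subset_of_nonneg (Finset.subset_univ _)
      fun y _ _ => Finset.prod_nonneg fun i _ => ENNReal.toReal_nonneg
  calc ∑ y ∈ decodingSet q V γ u x, ∏ i, auxOutProb q V (u i) (y i)
      ≤ ∑ y ∈ decodingSet q V γ u x, (∏ i, (V (x i) (y i)).toReal) *
          (Real.exp (-(n * γ)) * ∏ i, auxProb q (u i)) := by
        refine Finset.sum_le_sum fun y hy => ?_
        have := (Finset.mem_filter.1 hy).2
        have h2 := mul_le_mul_of_nonneg_left this (Real.exp_pos (-(n * γ))).le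
        rw [← mul_assoc, ← Real.exp_add, neg_add_cancel, Real.exp_zero, one_mul] at h2
        linarith
    _ ≤ _ := by
        rw [← Finset.sum_mul]
        exact mul_le_of_le_one_left (mul_nonneg (Real.exp_pos _).le hq) hV

theorem sum_compl_sdiff_biUnion_le {ι β : Type} [Fintype β] [DecidableEq β]
    {f : β → ℝ} (hf : ∀ b, 0 ≤ f b)
    (A : Finset β) (S : Finset ι) (t : ι → Finset β) :
    ∑ b ∈ (A \ S.biUnion t)ᶜ, f b ≤ ∑ b ∈ Aᶜ, f b + ∑ i ∈ S, ∑ b ∈ t i, f b := by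
  have hunion : ∀ s s' : Finset β, ∑ b ∈ s ∪ s', f b ≤ ∑ b ∈ s, f b + ∑ b ∈ s', f b := by
    intro s s'
    rw [← Finset.sum_union_inter]
    exact le_add_of_nonneg_right (Finset.sum_nonneg fun b _ => hf b)
  induction S using Finset.induction_on with
  | empty => simp
  | insert i S hi ih =>
    have hset : (A \ (insert i S).biUnion t)ᶜ = t i ∪ (A \ S.biUnion t)ᶜ := by
      ext b
      simp only [Finset.biUnion_insert, Finset.mem_compl, Finset.mem_sdiff, Finset.mem_union]
      tauto
    rw [hset, Finset.sum_insert hi]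
    linarith [hunion (t i) (A \ S.biUnion t)ᶜ]

/-- Probability, given input word `x`, of leaving the decoding set of `x` or of hitting the
decoding set of one of the competing words in `S`. -/
def greedyErr {U X Y : Type} [Fintype X] [Fintype Y] (q : PMF (U × X)) (V : X → PMF Y) (γ : ℝ)
    {n : ℕ} (u : Fin n → U) (S : Finset (Fin n → X)) (x : Fin n → X) : ℝ :=
  ∑ y ∈ (decodingSet q V γ u x \ S.biUnion (decodingSet q V γ u))ᶜ, ∏ i, (V (x i) (y i)).toReal

theorem sum_mul_greedyErr_le {U X Y : Type} [Fintype X] [Fintype Y] (q : PMF (U × X))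
    (V : X → PMF Y) (γ : ℝ) {n : ℕ} (u : Fin n → U) (S : Finset (Fin n → X)) :
    ∑ x : Fin n → X, (∏ i, (q (u i, x i)).toReal) * greedyErr q V γ u S x
      ≤ ∑ x : Fin n → X, (∏ i, (q (u i, x i)).toReal) *
          ∑ y ∈ (decodingSet q V γ u x)ᶜ, ∏ i, (V (x i) (y i)).toReal
        + S.card * Real.exp (-(n * γ)) * ∏ i, auxProb q (u i) := by
  have hstep : ∀ x, greedyErr q V γ u S x ≤
      ∑ y ∈ (decodingSet q V γ u x)ᶜ, ∏ i, (V (x i) (y i)).toReal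
      + ∑ x' ∈ S, ∑ y ∈ decodingSet q V γ u x', ∏ i, (V (x i) (y i)).toReal := fun x =>
    sum_compl_sdiff_biUnion_le
      (fun y => Finset.prod_nonneg fun i _ => ENNReal.toReal_nonneg) _ _ _
  calc _ ≤ ∑ x : Fin n → X, (∏ i, (q (u i, x i)).toReal) *
        (∑ y ∈ (decodingSet q V γ u x)ᶜ, ∏ i, (V (x i) (y i)).toReal
        + ∑ x' ∈ S, ∑ y ∈ decodingSet q V γ u x', ∏ i, (V (x i) (y i)).toReal) :=
        Finset.sum_le_sum fun x _ => mul_le_mul_of_nonneg_left (hstep x)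
          (Finset.prod_nonneg fun i _ => ENNReal.toReal_nonneg)
    _ = ∑ x : Fin n → X, (∏ i, (q (u i, x i)).toReal) *
          ∑ y ∈ (decodingSet q V γ u x)ᶜ, ∏ i, (V (x i) (y i)).toReal
        + ∑ x' ∈ S, ∑ y ∈ decodingSet q V γ u x', ∏ i, auxOutProb q V (u i) (y i) := by
        simp only [mul_add, Finset.sum_add_distrib, ← sum_prod_input_mul_output, Finset.mul_sum]
        congr 1
        rw [Finset.sum_comm]
        exact Finset.sum_congr rfl fun x' _ => Finset.sum_comm
    _ ≤ _ := by
        gcongr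
        refine (Finset.sum_le_card_nsmul S _ _ fun x' _ => sum_decodingSet_le q V γ u x').trans ?_
        rw [nsmul_eq_mul, mul_assoc]

/-- For all large `n` there is a time-sharing word `u` such that, against any two sufficiently small
families of competing words, some input word is good for both channels simultaneously. -/
theorem eventually_exists_greedy_step {U X Y Z : Type} [Fintype U] [Fintype X] [Fintype Y]
    [Fintype Z] (q : PMF (U × X)) (V : X → PMF Y) (V' : X → PMF Z) {γ γ' δ ε : ℝ}
    (hγ : γ < condMI (jointLaw q V)) (hγ' : γ' < condMI (jointLaw q V'))
    (hδ : 0 < δ) (hε : 0 < ε) :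
    ∀ᶠ n : ℕ in Filter.atTop, ∃ u : Fin n → U, ∀ S T : Finset (Fin n → X),
      S.card ≤ Real.exp (n * (γ - δ)) → T.card ≤ Real.exp (n * (γ' - δ)) →
      ∃ x, greedyErr q V γ u S x ≤ ε ∧ greedyErr q V' γ' u T x ≤ ε := by
  obtain ⟨r, hr0, hr1, hr⟩ := exists_pow_bound_compl_decodingSet q V hγ
  obtain ⟨r', hr0', hr1', hr'⟩ := exists_pow_bound_compl_decodingSet q V' hγ'
  have hlim : Filter.Tendsto (fun n : ℕ => (r ^ n + r' ^ n) + 2 * Real.exp (-δ) ^ n)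
      Filter.atTop (nhds ((0 + 0) + 2 * 0)) :=
    ((tendsto_pow_atTop_nhds_zero_of_lt_one hr0 hr1).add
      (tendsto_pow_atTop_nhds_zero_of_lt_one hr0' hr1')).add
      ((tendsto_pow_atTop_nhds_zero_of_lt_one (Real.exp_pos _).le
        (Real.exp_lt_one_iff.2 (neg_lt_zero.2 hδ))).const_mul 2)
  filter_upwards [hlim.eventually_lt_const (show (0 + 0) + 2 * 0 < ε by simpa using hε)] with n hn
  rw [← Real.exp_nat_mul] at hn
  set F : (Fin n → U) → ℝ := fun u => ∑ x : Fin n → X, (∏ i, (q (u i, x i)).toReal) *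
    ∑ y ∈ (decodingSet q V γ u x)ᶜ, ∏ i, (V (x i) (y i)).toReal with hF
  set F' : (Fin n → U) → ℝ := fun u => ∑ x : Fin n → X, (∏ i, (q (u i, x i)).toReal) *
    ∑ y ∈ (decodingSet q V' γ' u x)ᶜ, ∏ i, (V' (x i) (y i)).toReal with hF'
  have hFr : ∑ u, F u ≤ r ^ n := hr n
  have hFr' : ∑ u, F' u ≤ r' ^ n := hr' n
  obtain ⟨u, -, hu⟩ : ∃ u ∈ Finset.univ, F u + F' u <
      (ε - 2 * Real.exp (n * -δ)) * ∏ i, auxProb q (u i) := by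
    refine Finset.exists_lt_of_sum_lt ?_
    rw [← Finset.mul_sum, sum_prod_auxProb, Finset.sum_add_distrib]
    linarith
  refine ⟨u, fun S T hS hT => ?_⟩
  have hq : 0 ≤ ∏ i, auxProb q (u i) :=
    Finset.prod_nonneg fun i _ => Finset.sum_nonneg fun _ _ => ENNReal.toReal_nonneg
  have hcard : ∀ (c g : ℝ), c ≤ Real.exp (n * (g - δ)) →
      c * Real.exp (-(n * g)) * ∏ i, auxProb q (u i)
        ≤ Real.exp (n * -δ) * ∏ i, auxProb q (u i) := by
    intro c g hc
    refine mul_le_mul_of_nonneg_right ?_ hq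
    refine (mul_le_mul_of_nonneg_right hc (Real.exp_pos _).le).trans_eq ?_
    rw [← Real.exp_add]
    ring_nf
  have h1 := (sum_mul_greedyErr_le q V γ u S).trans (add_le_add_right (hcard _ γ hS) _)
  have h2 := (sum_mul_greedyErr_le q V' γ' u T).trans (add_le_add_right (hcard _ γ' hT) _)
  obtain ⟨x, -, hx⟩ : ∃ x ∈ Finset.univ, (∏ i, (q (u i, x i)).toReal) *
      (greedyErr q V γ u S x + greedyErr q V' γ' u T x)
      < (∏ i, (q (u i, x i)).toReal) * ε := by
    refine Finset.exists_lt_of_sum_lt ?_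
    rw [← Finset.sum_mul, sum_prod_input]
    simp only [mul_add, Finset.sum_add_distrib]
    simp only [hF, hF'] at hu
    linarith
  have hx := lt_of_mul_lt_mul_left hx (Finset.prod_nonneg fun i _ => ENNReal.toReal_nonneg)
  have hnn : 0 ≤ greedyErr q V γ u S x := Finset.sum_nonneg fun y _ =>
    Finset.prod_nonneg fun i _ => ENNReal.toReal_nonneg
  have hnn' : 0 ≤ greedyErr q V' γ' u T x := Finset.sum_nonneg fun y _ =>
    Finset.prod_nonneg fun i _ => ENNReal.toReal_nonneg
  exact ⟨x, by linarith, by linarith⟩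

/-- Fill an array entry by entry, each entry depending on the preceding entries of its row and
column. -/
theorem exists_array {α : Type} [DecidableEq α] {m k : ℕ} (E : Finset α → Finset α → α → Prop)
    (h : ∀ S T : Finset α, S.card < k → T.card < m → ∃ x, E S T x) :
    ∃ f : Fin m × Fin k → α, ∀ a b, E ((Finset.Iio b).image fun b' => f (a, b'))
      ((Finset.Iio a).image fun a' => f (a', b)) (f (a, b)) := by
  have hex : ∀ (v : Fin m × Fin k)
      (g : ∀ w : Fin m × Fin k, w.1.val + w.2.val < v.1.val + v.2.val → α), ∃ x,
      E ((Finset.Iio v.2).attach.image fun b' => g (v.1, b'.1)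
          (Nat.add_lt_add_left (Fin.lt_def.1 (Finset.mem_Iio.1 b'.2)) _))
        ((Finset.Iio v.1).attach.image fun a' => g (a'.1, v.2)
          (Nat.add_lt_add_right (Fin.lt_def.1 (Finset.mem_Iio.1 a'.2)) _)) x := by
    intro v g
    apply h
    · refine Finset.card_image_le.trans_lt ?_
      simp
    · refine Finset.card_image_le.trans_lt ?_
      simp
  choose G hG using hex
  let wf := (measure fun v : Fin m × Fin k => v.1.val + v.2.val).wf
  refine ⟨wf.fix G, fun a b => ?_⟩
  rw [wf.fix_eq G (a, b)]
  convert hG (a, b) (fun w _ => wf.fix G w) using 1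
  · ext z
    simp
  · ext z
    simp
  · rfl

theorem prodProb_comp_map {X Y₁ Y₂ Z : Type} [Fintype Y₁] [Fintype Y₂] [Fintype Z]
    (W : X → PMF (Y₁ × Y₂)) (g : Y₁ × Y₂ → Z) {n : ℕ} (x : Fin n → X)
    (E : (Fin n → Z) → Prop) :
    prodProb W x (fun y => E fun i => g (y i))
      = ∑ z ∈ Finset.univ.filter E, ∏ i, (((W (x i)).map g) (z i)).toReal := by
  have hz : ∀ z : Fin n → Z, ∏ i, (((W (x i)).map g) (z i)).toReal
      = ∑ y : Fin n → Y₁ × Y₂,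
          if (fun i => g (y i)) = z then ∏ i, ((W (x i)) (y i)).toReal else 0 := by
    intro z
    simp only [toReal_map_apply]
    rw [Finset.prod_univ_sum, Fintype.piFinset_univ]
    refine Finset.sum_congr rfl fun y _ => ?_
    rw [Finset.prod_ite_zero]
    by_cases h : (fun i => g (y i)) = z
    · rw [if_pos h, if_pos fun i _ => congrFun h i]
    · rw [if_neg h, if_neg fun h' => h (funext fun i => h' i (Finset.mem_univ i))]
  rw [Finset.sum_congr rfl fun z _ => hz z, Finset.sum_comm, prodProb, Finset.sum_filter]
  refine Finset.sum_congr rfl fun y _ => ?_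
  simp [Finset.sum_ite_eq]

theorem prodProb_comp_map_le {X Y₁ Y₂ Z : Type} [Fintype Y₁] [Fintype Y₂] [Fintype Z]
    (W : X → PMF (Y₁ × Y₂)) (g : Y₁ × Y₂ → Z) {n : ℕ} (x : Fin n → X)
    {E : (Fin n → Z) → Prop} {T : Finset (Fin n → Z)} (hE : ∀ z, E z → z ∈ T) :
    prodProb W x (fun y => E fun i => g (y i))
      ≤ ∑ z ∈ T, ∏ i, (((W (x i)).map g) (z i)).toReal := by
  rw [prodProb_comp_map]
  exact Finset.sum_le_sum_of_subset_of_nonneg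
    (fun z hz => hE z (Finset.mem_filter.1 hz).2)
    fun y _ _ => Finset.prod_nonneg fun i _ => ENNReal.toReal_nonneg

/-- Decode to the first index whose set contains the observation. -/
def firstIndex {β : Type} {k : ℕ} (D : Fin k → Finset β) (y : β) : Option (Fin k) :=
  if h : ∃ b, y ∈ D b ∧ ∀ b' < b, y ∉ D b' then some h.choose else none

theorem firstIndex_eq_some {β : Type} {k : ℕ} {D : Fin k → Finset β} {y : β} {b : Fin k}
    (hb : y ∈ D b) (hb' : ∀ b' < b, y ∉ D b') : firstIndex D y = some b := by
  have h : ∃ b, y ∈ D b ∧ ∀ b' < b, y ∉ D b' := ⟨b, hb, hb'⟩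
  rw [firstIndex, dif_pos h, Option.some_inj]
  rcases lt_trichotomy h.choose b with hlt | heq | hgt
  · exact absurd h.choose_spec.1 (hb' _ hlt)
  · exact heq
  · exact absurd hb (h.choose_spec.2 _ hgt)

theorem prodProb_firstIndex_ne_le {U X Y₁ Y₂ Z : Type} [Fintype X] [Fintype Y₁] [Fintype Y₂]
    [Fintype Z] (W : X → PMF (Y₁ × Y₂)) (g : Y₁ × Y₂ → Z) (q : PMF (U × X)) (γ : ℝ) {n k : ℕ}
    (u : Fin n → U) (f : Fin k → Fin n → X) (b : Fin k) :
    prodProb W (f b) (fun y => firstIndex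
        (fun b' => decodingSet q (fun x => (W x).map g) γ u (f b')) (fun i => g (y i)) ≠ some b)
      ≤ greedyErr q (fun x => (W x).map g) γ u ((Finset.Iio b).image f) (f b) := by
  refine prodProb_comp_map_le W g (f b) (E := fun z => firstIndex
    (fun b' => decodingSet q (fun x => (W x).map g) γ u (f b')) z ≠ some b) fun z hz => ?_
  rw [Finset.mem_compl]
  intro hmem
  refine hz (firstIndex_eq_some (Finset.mem_sdiff.1 hmem).1 ?_)
  intro b' hlt hmem'
  exact (Finset.mem_sdiff.1 hmem).2 (Finset.mem_biUnion.2
    ⟨f b', Finset.mem_image_of_mem f (Finset.mem_Iio.2 hlt), hmem'⟩)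

theorem joint₁_eq_jointLaw {U : Type} (W : 𝒳 → PMF (𝒴₁ × 𝒴₂)) (q : PMF (U × 𝒳)) :
    joint₁ W q = jointLaw q fun x => (W x).map Prod.fst := by
  simp only [joint₁, jointLaw, PMF.map_comp]
  rfl

theorem joint₂_eq_jointLaw {U : Type} (W : 𝒳 → PMF (𝒴₁ × 𝒴₂)) (q : PMF (U × 𝒳)) :
    joint₂ W q = jointLaw q fun x => (W x).map Prod.snd := by
  simp only [joint₂, jointLaw, PMF.map_comp]
  rfl

/-- A message set of rate at least `R` in which each message has fewer than `exp (n * R)`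
predecessors. -/
theorem exists_message_count (R : ℝ) {n : ℕ} (hn : 0 < n) :
    ∃ M : ℕ, 1 ≤ M ∧ R ≤ Real.log M / n ∧ ∀ s : ℕ, s < M → (s : ℝ) ≤ Real.exp (n * R) := by
  have hpos := Real.exp_pos (n * R)
  refine ⟨⌈Real.exp (n * R)⌉₊, Nat.ceil_pos.2 hpos, ?_, fun s hs => (Nat.lt_ceil.1 hs).le⟩
  rw [le_div_iff₀ (by exact_mod_cast hn), mul_comm]
  exact (Real.le_log_iff_exp_le (hpos.trans_le (Nat.le_ceil _))).2 (Nat.le_ceil _)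

/-- **Achievability part of the capacity theorem for the bidirectional broadcast
channel**: every rate pair `(R₂, R₁)` in the information region is achievable with
arbitrarily small maximum error probabilities. -/
theorem achievability [Fintype 𝒳] [Nonempty 𝒳] [Fintype 𝒴₁] [Nonempty 𝒴₁]
    [Fintype 𝒴₂] [Nonempty 𝒴₂]
    (W : 𝒳 → PMF (𝒴₁ × 𝒴₂)) (R₂ R₁ : ℝ) (hR : (R₂, R₁) ∈ infoRegion W)
    (δ ε : ℝ) (hδ : 0 < δ) (hε : 0 < ε) :
    ∃ (n M₁ M₂ : ℕ) (c : Code 𝒳 𝒴₁ 𝒴₂ M₁ M₂ n),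
      0 < n ∧ 1 ≤ M₁ ∧ 1 ≤ M₂ ∧
      R₂ - δ ≤ Real.log M₁ / n ∧ R₁ - δ ≤ Real.log M₂ / n ∧
      (∀ v, err₁ W c v ≤ ε) ∧ (∀ v, err₂ W c v ≤ ε) := by
  obtain ⟨-, -, U, iU, q, h2, h1⟩ := hR
  rw [joint₂_eq_jointLaw] at h2
  rw [joint₁_eq_jointLaw] at h1
  have hstep := eventually_exists_greedy_step q (fun x => (W x).map Prod.fst)
    (fun x => (W x).map Prod.snd) (γ := R₁ - δ / 2) (γ' := R₂ - δ / 2)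
    (by linarith) (by linarith) (half_pos hδ) hε
  obtain ⟨n, ⟨u, hu⟩, hn⟩ := (hstep.and (Filter.eventually_gt_atTop 0)).exists
  rw [show R₁ - δ / 2 - δ / 2 = R₁ - δ by ring, show R₂ - δ / 2 - δ / 2 = R₂ - δ by ring] at hu
  obtain ⟨M₁, hM₁, hrate₁, hsize₁⟩ := exists_message_count (R₂ - δ) hn
  obtain ⟨M₂, hM₂, hrate₂, hsize₂⟩ := exists_message_count (R₁ - δ) hn
  obtain ⟨f, hf⟩ := exists_array (m := M₁) (k := M₂) _
    fun S T hS hT => hu S T (hsize₂ _ hS) (hsize₁ _ hT)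
  refine ⟨n, M₁, M₂,
    { enc := f
      dec₁ := fun p => firstIndex (fun b => decodingSet q (fun x => (W x).map Prod.fst)
        (R₁ - δ / 2) u (f (p.2, b))) p.1
      dec₂ := fun p => firstIndex (fun a => decodingSet q (fun x => (W x).map Prod.snd)
        (R₂ - δ / 2) u (f (a, p.2))) p.1 },
    hn, hM₁, hM₂, hrate₁, hrate₂, ?_, ?_⟩
  · rintro ⟨a, b⟩
    exact (prodProb_firstIndex_ne_le W Prod.fst q _ u (fun b' => f (a, b')) b).trans (hf a b).1
  · rintro ⟨a, b⟩
    exact (prodProb_firstIndex_ne_le W Prod.snd q _ u (fun a' => f (a', b)) a).trans (hf a b).2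

end BDBC
end
end

section
/- Converse for the average error probability with small error parameters: let W : 𝒳 → PMF(𝒴₁ × 𝒴₂) be a discrete memoryless broadcast channel and let ε₁, ε₂ satisfy either ε₁ ∈ (0, 1/2) and ε₂ ∈ (0, 1/4), or ε₁ ∈ (0, 1/4) and ε₂ ∈ (0, 1/2). If the pair (R₂, R₁) is [ε₁,ε₂]-achievable with respect to the average error probability, i.e. for every δ > 0 there exist n(δ) ∈ ℕ and (M₁⁽ⁿ⁾, M₂⁽ⁿ⁾, n)-codes for all n ≥ n(δ) with (log M₁⁽ⁿ⁾)/n ≥ R₂ − δ, (log M₂⁽ⁿ⁾)/n ≥ R₁ − δ, μ₁⁽ⁿ⁾ ≤ ε₁ and μ₂⁽ⁿ⁾ ≤ ε₂, then (R₂, R₁) belongs to the information region 𝒞 of W. -/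
open scoped Classical BigOperators

noncomputable section

namespace BDBC

variable {𝒳 𝒴₁ 𝒴₂ : Type}

section Toolkit

open Finset

variable {Y Z : Type}

/-- Output distribution of the channel `V` under the input distribution `P`. -/
def outputLaw [Fintype 𝒳] (P : 𝒳 → ℝ) (V : 𝒳 → Y → ℝ) (y : Y) : ℝ :=
  ∑ a, P a * V a y

/-- Mutual information between input and output of the channel `V` under the input
distribution `P`. -/
def mutualInfo [Fintype 𝒳] [Fintype Y] (P : 𝒳 → ℝ) (V : 𝒳 → Y → ℝ) : ℝ :=
  ∑ y, Real.negMulLog (outputLaw P V y) - ∑ a, P a * ∑ y, Real.negMulLog (V a y)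

/-- Empirical distribution (type) of a word. -/
def empirical {n : ℕ} (x : Fin n → 𝒳) (a : 𝒳) : ℝ :=
  (#{i | x i = a} : ℝ) / n

/-- Channel obtained from `W` by observing only the image of the output under `π`. -/
def margChannel [Fintype Z] (W : 𝒳 → PMF Z) (π : Z → Y) (a : 𝒳) (y : Y) : ℝ :=
  ∑ z with π z = y, (W a z).toReal

lemma sum_toReal_pmf [Fintype Z] (p : PMF Z) : ∑ z, (p z).toReal = 1 := by
  rw [← ENNReal.toReal_sum fun z _ => p.apply_ne_top z, ← tsum_fintype (L := .unconditional _),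
    p.tsum_coe, ENNReal.toReal_one]

lemma margChannel_nonneg [Fintype Z] (W : 𝒳 → PMF Z) (π : Z → Y) (a : 𝒳) (y : Y) :
    0 ≤ margChannel W π a y :=
  sum_nonneg fun _ _ => ENNReal.toReal_nonneg

lemma sum_margChannel [Fintype Z] [Fintype Y] (W : 𝒳 → PMF Z) (π : Z → Y) (a : 𝒳) :
    ∑ y, margChannel W π a y = 1 := by
  rw [← sum_toReal_pmf (W a), ← sum_fiberwise univ π]
  rfl

lemma sum_prod_fiber [Fintype Z] [Fintype Y] {n : ℕ} (W : 𝒳 → PMF Z) (π : Z → Y)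
    (x : Fin n → 𝒳) (E : (Fin n → Y) → Prop) :
    ∑ z : Fin n → Z with E (fun i => π (z i)), ∏ i, (W (x i) (z i)).toReal =
      ∑ y with E y, ∏ i, margChannel W π (x i) (y i) := by
  unfold margChannel
  simp_rw [prod_univ_sum]
  rw [← sum_fiberwise_of_maps_to (t := univ.filter E) (g := fun z i => π (z i))]
  · refine sum_congr rfl fun y hy => sum_congr ?_ fun _ _ => rfl
    ext z
    simp only [mem_filter, mem_univ, true_and, Fintype.mem_piFinset] at hy ⊢
    constructor
    · rintro ⟨_, rfl⟩ i; rfl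
    · intro h
      have : (fun i => π (z i)) = y := funext h
      exact ⟨by rwa [this], this⟩
  · intro z hz
    simpa using hz

lemma sum_prod_eq_one [Fintype Y] {n : ℕ} {p : Fin n → Y → ℝ} (hp : ∀ i, ∑ y, p i y = 1) :
    ∑ y : Fin n → Y, ∏ i, p i (y i) = 1 := by
  rw [← Fintype.piFinset_univ, ← prod_univ_sum]
  simp [hp]

/-- A sum of independent centred variables is centred, and its variance is the sum of the
variances. -/
lemma sum_prod_mul_moments [Fintype Y] {n : ℕ} {p g : Fin n → Y → ℝ}
    (hp : ∀ i, ∑ y, p i y = 1) (hg : ∀ i, ∑ y, p i y * g i y = 0) :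
    ∑ y : Fin n → Y, (∏ i, p i (y i)) * ∑ i, g i (y i) = 0 ∧
    ∑ y : Fin n → Y, (∏ i, p i (y i)) * (∑ i, g i (y i)) ^ 2 =
      ∑ i, ∑ y, p i y * g i y ^ 2 := by
  induction n with
  | zero => simp
  | succ n ih =>
    obtain ⟨h1, h2⟩ := ih (fun i => hp i.succ) (fun i => hg i.succ)
    have h0 := sum_prod_eq_one fun i : Fin n => hp i.succ
    constructor
    · rw [← (Fin.consEquiv fun _ => Y).sum_comp, Fintype.sum_prod_type]
      simp only [Fin.consEquiv_apply, Fin.prod_univ_succ, Fin.sum_univ_succ, Fin.cons_zero,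
        Fin.cons_succ]
      have : ∀ (a : Y) (b : Fin n → Y),
          p 0 a * (∏ i : Fin n, p i.succ (b i)) * (g 0 a + ∑ i : Fin n, g i.succ (b i)) =
          (p 0 a * g 0 a) * (∏ i : Fin n, p i.succ (b i)) +
          p 0 a * ((∏ i : Fin n, p i.succ (b i)) * ∑ i : Fin n, g i.succ (b i)) := by
        intros; ring
      simp only [this, sum_add_distrib, ← mul_sum, h0, h1, mul_one, mul_zero, add_zero, hg]
    · rw [← (Fin.consEquiv fun _ => Y).sum_comp, Fintype.sum_prod_type]
      simp only [Fin.consEquiv_apply, Fin.prod_univ_succ, Fin.sum_univ_succ, Fin.cons_zero,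
        Fin.cons_succ]
      have : ∀ (a : Y) (b : Fin n → Y),
          p 0 a * (∏ i : Fin n, p i.succ (b i)) * (g 0 a + ∑ i : Fin n, g i.succ (b i)) ^ 2 =
          (p 0 a * g 0 a ^ 2) * (∏ i : Fin n, p i.succ (b i)) +
          (2 * (p 0 a * g 0 a)) * ((∏ i : Fin n, p i.succ (b i)) * ∑ i : Fin n, g i.succ (b i)) +
          p 0 a * ((∏ i : Fin n, p i.succ (b i)) * (∑ i : Fin n, g i.succ (b i)) ^ 2) := by
        intros; ring
      simp only [this, sum_add_distrib, ← mul_sum, h0, h1, h2, mul_one, mul_zero, add_zero,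
        ← sum_mul, hp, one_mul]

/-- Chebyshev's inequality for sums of independent variables over a finite product space. -/
lemma chebyshev_sum_prod [Fintype Y] {n : ℕ} {p L : Fin n → Y → ℝ} (hp0 : ∀ i y, 0 ≤ p i y)
    (hp : ∀ i, ∑ y, p i y = 1) {t : ℝ} (ht : 0 < t) :
    ∑ y : Fin n → Y with (∑ i, ∑ b, p i b * L i b) + t < ∑ i, L i (y i), ∏ i, p i (y i) ≤
      (∑ i, ∑ y, p i y * L i y ^ 2) / t ^ 2 := by
  set m : Fin n → ℝ := fun i => ∑ b, p i b * L i b with hm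
  set g : Fin n → Y → ℝ := fun i y => L i y - m i with hgdef
  have hg : ∀ i, ∑ y, p i y * g i y = 0 := by
    intro i
    simp only [hgdef, mul_sub, sum_sub_distrib, ← sum_mul, hp, one_mul]
    simp [hm]
  have hvar := (sum_prod_mul_moments hp hg).2
  have hpos : ∀ y : Fin n → Y, 0 ≤ ∏ i, p i (y i) := fun y => prod_nonneg fun i _ => hp0 i _
  have hle : ∑ i, ∑ y, p i y * g i y ^ 2 ≤ ∑ i, ∑ y, p i y * L i y ^ 2 := by
    refine sum_le_sum fun i _ => ?_
    have : ∑ y, p i y * g i y ^ 2 = ∑ y, p i y * L i y ^ 2 - m i ^ 2 := by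
      have e : ∀ y, p i y * g i y ^ 2 =
          p i y * L i y ^ 2 - (p i y * L i y) * (2 * m i) + p i y * m i ^ 2 := by
        intro y; simp only [hgdef]; ring
      simp only [e, sum_add_distrib, sum_sub_distrib, ← sum_mul, hp]
      change _ - m i * _ + _ = _
      ring
    rw [this]
    linarith [sq_nonneg (m i)]
  rw [le_div_iff₀ (by positivity), sum_mul]
  refine le_trans ?_ (hvar.le.trans hle)
  refine le_trans (sum_le_sum fun y hy => ?_)
    (sum_le_sum_of_subset_of_nonneg (filter_subset _ _) fun y _ _ =>
      mul_nonneg (hpos y) (sq_nonneg (∑ i, g i (y i))))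
  refine mul_le_mul_of_nonneg_left ?_ (hpos y)
  have : t < ∑ i, g i (y i) := by
    simp only [hgdef, sum_sub_distrib]
    have := (mem_filter.1 hy).2
    linarith
  gcongr

lemma mul_log_sq_le_four {t : ℝ} (h0 : 0 ≤ t) (h1 : t ≤ 1) : t * Real.log t ^ 2 ≤ 4 := by
  rcases h0.eq_or_lt with rfl | h0
  · simp
  have h := Real.abs_log_mul_self_lt (Real.sqrt t) (Real.sqrt_pos.2 h0)
    (Real.sqrt_le_one.2 h1)
  rw [Real.log_sqrt h0.le] at h
  have h2 : (Real.log t / 2 * Real.sqrt t) ^ 2 ≤ 1 := by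
    rw [← sq_abs]
    exact pow_le_one₀ (abs_nonneg _) h.le
  rw [mul_pow, Real.sq_sqrt h0.le] at h2
  nlinarith

section Empirical

variable {n : ℕ}

lemma sum_comp_eq_empirical [Fintype 𝒳] (hn : 0 < n) (x : Fin n → 𝒳) (f : 𝒳 → ℝ) :
    ∑ i, f (x i) = n * ∑ a, empirical x a * f a := by
  have hn' : (n : ℝ) ≠ 0 := by positivity
  rw [← sum_fiberwise univ x, mul_sum]
  refine sum_congr rfl fun a _ => ?_
  rw [sum_congr rfl fun i hi => by rw [(mem_filter.1 hi).2], sum_const, nsmul_eq_mul, empirical]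
  field_simp

lemma empirical_mem_stdSimplex [Fintype 𝒳] (hn : 0 < n) (x : Fin n → 𝒳) :
    empirical x ∈ stdSimplex ℝ 𝒳 := by
  refine ⟨fun a => by unfold empirical; positivity, ?_⟩
  have := sum_comp_eq_empirical hn x fun _ => 1
  have hn' : (n : ℝ) ≠ 0 := by positivity
  simpa [hn'] using this.symm

lemma empirical_pos (x : Fin n → 𝒳) (i : Fin n) : 0 < empirical x (x i) := by
  have : 0 < #{j | x j = x i} := card_pos.2 ⟨i, by simp⟩
  have hn : 0 < n := i.pos
  unfold empirical
  positivity

end Empirical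

section StrongConverse

variable [Fintype 𝒳] {V : 𝒳 → Y → ℝ} {P : 𝒳 → ℝ}

lemma outputLaw_nonneg (hP : P ∈ stdSimplex ℝ 𝒳) (hV0 : ∀ a y, 0 ≤ V a y) (y : Y) :
    0 ≤ outputLaw P V y :=
  sum_nonneg fun a _ => mul_nonneg (hP.1 a) (hV0 a y)

variable [Fintype Y]

lemma sum_outputLaw (hP : P ∈ stdSimplex ℝ 𝒳) (hV1 : ∀ a, ∑ y, V a y = 1) :
    ∑ y, outputLaw P V y = 1 := by
  unfold outputLaw
  rw [sum_comm]
  simp only [← mul_sum, hV1, mul_one]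
  exact hP.2

lemma sum_mul_outputLaw (f : Y → ℝ) :
    ∑ a, P a * ∑ y, V a y * f y = ∑ y, outputLaw P V y * f y := by
  simp only [outputLaw, sum_mul, mul_sum]
  rw [sum_comm]
  simp only [mul_assoc]

lemma sum_information_density :
    ∑ a, P a * ∑ y, V a y * (Real.log (V a y) - Real.log (outputLaw P V y)) =
      mutualInfo P V := by
  simp only [mul_sub, sum_sub_distrib, sum_mul_outputLaw, mutualInfo, Real.negMulLog]
  simp only [neg_mul, sum_neg_distrib, mul_neg]
  ring

lemma sum_information_density_sq_le (hP : P ∈ stdSimplex ℝ 𝒳) (hV0 : ∀ a y, 0 ≤ V a y)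
    (hV1 : ∀ a, ∑ y, V a y = 1) :
    ∑ a, P a * ∑ y, V a y * (Real.log (V a y) - Real.log (outputLaw P V y)) ^ 2 ≤
      16 * Fintype.card Y := by
  have hle : ∀ a y, V a y ≤ 1 := fun a y =>
    (hV1 a).symm ▸ single_le_sum (f := V a) (fun y _ => hV0 a y) (mem_univ y)
  have hQle : ∀ y, outputLaw P V y ≤ 1 := fun y =>
    (sum_outputLaw hP hV1).symm ▸
      single_le_sum (f := outputLaw P V) (fun y _ => outputLaw_nonneg hP hV0 y) (mem_univ y)
  calc ∑ a, P a * ∑ y, V a y * (Real.log (V a y) - Real.log (outputLaw P V y)) ^ 2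
      ≤ ∑ a, P a * ∑ y, (2 * (V a y * Real.log (V a y) ^ 2) +
          V a y * (2 * Real.log (outputLaw P V y) ^ 2)) := by
        refine sum_le_sum fun a _ => mul_le_mul_of_nonneg_left ?_ (hP.1 a)
        refine sum_le_sum fun y _ => ?_
        nlinarith [mul_nonneg (hV0 a y)
          (sq_nonneg (Real.log (V a y) + Real.log (outputLaw P V y)))]
    _ = ∑ a, P a * ∑ y, 2 * (V a y * Real.log (V a y) ^ 2) +
          ∑ y, outputLaw P V y * (2 * Real.log (outputLaw P V y) ^ 2) := by
        simp only [sum_add_distrib, mul_add, sum_mul_outputLaw]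
    _ ≤ ∑ a, P a * ∑ _y : Y, (8 : ℝ) + ∑ _y : Y, (8 : ℝ) := by
        gcongr with a _ y _ y _
        · exact hP.1 a
        · linarith [mul_log_sq_le_four (hV0 a y) (hle a y)]
        · linarith [mul_log_sq_le_four (outputLaw_nonneg hP hV0 y) (hQle y)]
    _ = 16 * Fintype.card Y := by
        rw [← sum_mul, hP.2]
        simp
        ring

lemma prod_le_exp_mul_prod {n : ℕ} {v w : Fin n → ℝ} (hv : ∀ i, 0 ≤ v i) (hw : ∀ i, 0 ≤ w i)
    (hvw : ∀ i, 0 < v i → 0 < w i) {γ : ℝ}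
    (h : ∑ i, (Real.log (v i) - Real.log (w i)) ≤ γ) :
    ∏ i, v i ≤ Real.exp γ * ∏ i, w i := by
  by_cases hpos : ∀ i, 0 < v i
  · have e : ∀ u : Fin n → ℝ, (∀ i, 0 < u i) → ∏ i, u i = Real.exp (∑ i, Real.log (u i)) := by
      intro u hu
      rw [Real.exp_sum]
      exact prod_congr rfl fun i _ => (Real.exp_log (hu i)).symm
    rw [e v hpos, e w fun i => hvw i (hpos i), ← Real.exp_add]
    rw [sum_sub_distrib] at h
    exact Real.exp_le_exp.2 (by linarith)
  · push Not at hpos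
    obtain ⟨i, hi⟩ := hpos
    rw [prod_eq_zero (mem_univ i) (le_antisymm hi (hv i))]
    exact mul_nonneg (Real.exp_pos _).le (prod_nonneg fun i _ => hw i)

/-- Strong converse for codes of constant composition. -/
lemma card_le_of_constantComposition {ι : Type} {n : ℕ} (hn : 0 < n)
    (hV0 : ∀ a y, 0 ≤ V a y) (hV1 : ∀ a, ∑ y, V a y = 1) (S : Finset ι)
    (x : ι → Fin n → 𝒳) (hx : ∀ m ∈ S, empirical (x m) = P)
    (g : (Fin n → Y) → Option ι) {η δ : ℝ} (hδ : 0 < δ)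
    (hη : ∀ m ∈ S, η ≤ ∑ y with g y = some m, ∏ i, V (x m i) (y i))
    (hlarge : 16 * Fintype.card Y / (n * δ ^ 2) ≤ η / 2) :
    #S * (η / 2) ≤ Real.exp (n * (mutualInfo P V + δ)) := by
  rcases S.eq_empty_or_nonempty with rfl | ⟨m₀, hm₀⟩
  · simpa using (Real.exp_pos _).le
  have hn' : (0 : ℝ) < n := by positivity
  have hP : P ∈ stdSimplex ℝ 𝒳 := hx m₀ hm₀ ▸ empirical_mem_stdSimplex hn (x m₀)
  set Q := outputLaw P V with hQ
  have hQ0 : ∀ y, 0 ≤ Q y := outputLaw_nonneg hP hV0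
  have hQ1 : ∑ y : Fin n → Y, ∏ i, Q (y i) = 1 :=
    sum_prod_eq_one (p := fun _ => Q) fun _ => sum_outputLaw hP hV1
  have key : ∀ m ∈ S, η / 2 ≤ Real.exp (n * (mutualInfo P V + δ)) *
      ∑ y with g y = some m, ∏ i, Q (y i) := by
    intro m hm
    set L : Fin n → Y → ℝ := fun i y => Real.log (V (x m i) y) - Real.log (Q y) with hL
    have hmean : ∑ i, ∑ y, V (x m i) y * L i y = n * mutualInfo P V := by
      have := sum_comp_eq_empirical hn (x m)
        fun a => ∑ y, V a y * (Real.log (V a y) - Real.log (Q y))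
      rw [hx m hm, hQ, sum_information_density] at this
      exact this
    have hsq : ∑ i, ∑ y, V (x m i) y * L i y ^ 2 ≤ n * (16 * Fintype.card Y) := by
      have := sum_comp_eq_empirical hn (x m)
        fun a => ∑ y, V a y * (Real.log (V a y) - Real.log (Q y)) ^ 2
      rw [hx m hm] at this
      exact this.le.trans
        (mul_le_mul_of_nonneg_left (sum_information_density_sq_le hP hV0 hV1) hn'.le)
    have hcheb := chebyshev_sum_prod (p := fun i => V (x m i)) (L := L) (fun i => hV0 _)
      (fun i => hV1 _) (mul_pos hn' hδ)
    rw [hmean, ← mul_add] at hcheb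
    set γ : ℝ := n * (mutualInfo P V + δ) with hγ
    have htail : (∑ i, ∑ y, V (x m i) y * L i y ^ 2) / (n * δ) ^ 2 ≤ η / 2 := by
      refine le_trans ?_ hlarge
      calc _ ≤ n * (16 * Fintype.card Y) / (n * δ) ^ 2 := by gcongr
        _ = _ := by field_simp
    have hsplit : ∑ y with g y = some m, ∏ i, V (x m i) (y i) ≤
        Real.exp γ * ∑ y with g y = some m, ∏ i, Q (y i) +
        ∑ y : Fin n → Y with γ < ∑ i, L i (y i), ∏ i, V (x m i) (y i) := by
      rw [← sum_filter_add_sum_filter_not _ fun y : Fin n → Y => γ < ∑ i, L i (y i), add_comm]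
      refine add_le_add ?_ ?_
      · rw [mul_sum]
        refine le_trans (sum_le_sum fun y hy => ?_)
          (sum_le_sum_of_subset_of_nonneg (filter_subset _ _) fun y _ _ =>
            mul_nonneg (Real.exp_pos γ).le (prod_nonneg fun i _ => hQ0 (y i)))
        refine prod_le_exp_mul_prod (fun i => hV0 _ _) (fun i => hQ0 _) (fun i hi => ?_)
          (not_lt.1 (mem_filter.1 hy).2)
        have hpos := empirical_pos (x m) i
        rw [hx m hm] at hpos
        exact (mul_pos hpos hi).trans_le
          (single_le_sum (f := fun a => P a * V a (y i))
            (fun a _ => mul_nonneg (hP.1 a) (hV0 a _)) (mem_univ (x m i)))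
      · exact sum_le_sum_of_subset_of_nonneg
          (fun y hy => mem_filter.2 ⟨mem_univ _, (mem_filter.1 hy).2⟩)
          fun y _ _ => prod_nonneg fun i _ => hV0 _ _
    have := hη m hm
    linarith
  calc #S * (η / 2) = ∑ _m ∈ S, η / 2 := by rw [sum_const, nsmul_eq_mul]
    _ ≤ ∑ m ∈ S, Real.exp (n * (mutualInfo P V + δ)) *
        ∑ y with g y = some m, ∏ i, Q (y i) := sum_le_sum key
    _ = Real.exp (n * (mutualInfo P V + δ)) *
        ∑ m ∈ S, ∑ y with g y = some m, ∏ i, Q (y i) := by rw [mul_sum]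
    _ ≤ Real.exp (n * (mutualInfo P V + δ)) * 1 := by
        refine mul_le_mul_of_nonneg_left ?_ (Real.exp_pos _).le
        rw [← hQ1, ← sum_biUnion]
        · exact sum_le_sum_of_subset_of_nonneg (subset_univ _) fun y _ _ =>
            prod_nonneg fun i _ => hQ0 _
        · intro m _ m' _ hne
          refine disjoint_left.2 fun y hy hy' => hne ?_
          have h1 := (mem_filter.1 hy).2
          have h2 := (mem_filter.1 hy').2
          exact Option.some_injective _ (h1.symm.trans h2)
    _ = _ := mul_one _

end StrongConverse

section SingleLetter

lemma toReal_map_pmf [Fintype Z] (p : PMF Z) (f : Z → Y) (y : Y) :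
    (p.map f y).toReal = ∑ z with f z = y, (p z).toReal := by
  rw [PMF.map_apply, tsum_fintype, ENNReal.toReal_sum, sum_filter]
  · refine sum_congr rfl fun z _ => ?_
    by_cases h : f z = y
    · simp [h]
    · simp [h, Ne.symm h]
  · intro z _
    split_ifs
    · exact p.apply_ne_top z
    · exact ENNReal.zero_ne_top

lemma toReal_bind_pmf [Fintype Z] (p : PMF Z) (f : Z → PMF Y) (y : Y) :
    (p.bind f y).toReal = ∑ z, (p z).toReal * (f z y).toReal := by
  rw [PMF.bind_apply, tsum_fintype, ENNReal.toReal_sum]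
  · simp only [ENNReal.toReal_mul]
  · exact fun z _ => ENNReal.mul_ne_top (p.apply_ne_top z) ((f z).apply_ne_top y)

/-- With a trivial auxiliary variable the conditional mutual information is the mutual
information. -/
lemma condMI_bind_eq_mutualInfo [Fintype 𝒳] [Fintype Y] [Fintype Z] (W : 𝒳 → PMF Z) (π : Z → Y)
    (q : PMF (Unit × 𝒳)) {P : 𝒳 → ℝ} (hq : ∀ a, (q ((), a)).toReal = P a) :
    condMI (q.bind fun ux => (W ux.2).map fun z => (ux.1, ux.2, π z)) =
      mutualInfo P (margChannel W π) := by
  set J := q.bind fun ux => (W ux.2).map fun z => (ux.1, ux.2, π z) with hJ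
  have hsum : ∑ a, P a = 1 := by
    rw [← sum_toReal_pmf q, Fintype.sum_prod_type]
    simp [hq]
  have hJv : ∀ a y, (J ((), a, y)).toReal = P a * margChannel W π a y := by
    intro a y
    rw [hJ, toReal_bind_pmf, Fintype.sum_prod_type]
    simp only [univ_unique, PUnit.default_eq_unit, sum_singleton, toReal_map_pmf, hq]
    rw [sum_eq_single a]
    · simp [margChannel]
    · intro b _ hb
      simp [hb]
    · simp
  have hX : ∀ a, ((J.map fun z => (z.1, z.2.1)) ((), a)).toReal = P a := by
    intro a
    rw [toReal_map_pmf, sum_filter, Fintype.sum_prod_type]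
    simp only [univ_unique, PUnit.default_eq_unit, sum_singleton, Fintype.sum_prod_type, hJv,
      Prod.mk.injEq, true_and]
    rw [sum_eq_single a]
    · simp [← mul_sum, sum_margChannel]
    · intro b _ hb
      simp [hb]
    · simp
  have hY : ∀ y, ((J.map fun z => (z.1, z.2.2)) ((), y)).toReal =
      outputLaw P (margChannel W π) y := by
    intro y
    rw [toReal_map_pmf, sum_filter, Fintype.sum_prod_type]
    simp [Fintype.sum_prod_type, hJv, outputLaw]
  have hU : ((J.map Prod.fst) ()).toReal = 1 := by
    have := sum_toReal_pmf (J.map Prod.fst)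
    simpa using this
  simp only [condMI, pmfEntropy, Fintype.sum_prod_type, univ_unique, PUnit.default_eq_unit,
    sum_singleton, hX, hY, hU, hJv, Real.negMulLog_mul, Real.negMulLog_one, sum_add_distrib,
    ← mul_sum, ← sum_mul, sum_margChannel, mutualInfo, one_mul]
  ring

lemma continuous_mutualInfo [Fintype 𝒳] [Fintype Y] (V : 𝒳 → Y → ℝ) :
    Continuous fun P : 𝒳 → ℝ => mutualInfo P V := by
  unfold mutualInfo outputLaw
  have := Real.continuous_negMulLog
  fun_prop

/-- Pairs of rates that are approximately attained by input distributions are attained. -/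
lemma exists_mem_stdSimplex_of_approx [Fintype 𝒳] {F G : (𝒳 → ℝ) → ℝ} (hF : Continuous F)
    (hG : Continuous G) {r s : ℝ}
    (h : ∀ δ > 0, ∃ P ∈ stdSimplex ℝ 𝒳, r - δ ≤ F P ∧ s - δ ≤ G P) :
    ∃ P ∈ stdSimplex ℝ 𝒳, r ≤ F P ∧ s ≤ G P := by
  obtain ⟨P₀, hP₀, -⟩ := h 1 one_pos
  obtain ⟨P, hP, hmax⟩ := (isCompact_stdSimplex ℝ 𝒳).exists_isMaxOn ⟨P₀, hP₀⟩
    (f := fun P => min (F P - r) (G P - s)) (by fun_prop)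
  have h0 : 0 ≤ min (F P - r) (G P - s) := by
    refine le_of_forall_pos_sub_le fun δ hδ => ?_
    obtain ⟨P', hP', h1, h2⟩ := h δ hδ
    refine le_trans ?_ (hmax hP')
    exact le_min (by linarith) (by linarith)
  obtain ⟨h1, h2⟩ := le_min_iff.1 h0
  exact ⟨P, hP, by linarith, by linarith⟩

end SingleLetter

section Counting

lemma exists_card_ge_of_sum_le {ι : Type} [Fintype ι] (e : ι → ℝ) (he : ∀ v, 0 ≤ e v) {ε : ℝ}
    (hε0 : 0 ≤ ε) (hε1 : ε < 1) (h : ∑ v, e v ≤ ε * Fintype.card ι) :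
    (1 - ε) / 2 * Fintype.card ι ≤ #{v | e v ≤ 1 - (1 - ε) / 2} := by
  set A : Finset ι := {v | e v ≤ 1 - (1 - ε) / 2} with hA
  have h1 : (#A : ℝ) + #Aᶜ = Fintype.card ι := by exact_mod_cast card_add_card_compl A
  have h2 : #Aᶜ * ((1 + ε) / 2) ≤ ∑ v, e v := by
    rw [← nsmul_eq_mul]
    refine (card_nsmul_le_sum Aᶜ e _ fun v hv => ?_).trans
      (sum_le_sum_of_subset_of_nonneg (subset_univ _) fun v _ _ => he v)
    simp only [hA, mem_compl, mem_filter, mem_univ, true_and, not_le] at hv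
    linarith
  have h3 : (0 : ℝ) ≤ #A := by positivity
  nlinarith

lemma exists_empirical_eq_card_ge {ι : Type} [Fintype 𝒳] {n : ℕ} (A : Finset ι)
    (x : ι → Fin n → 𝒳) (hA : A.Nonempty) :
    ∃ v₀ ∈ A, (#A : ℝ) / (n + 1) ^ Fintype.card 𝒳 ≤
      #{v ∈ A | empirical (x v) = empirical (x v₀)} := by
  let counts : ι → 𝒳 → Fin (n + 1) := fun v a =>
    ⟨#{i | x v i = a}, Nat.lt_succ_of_le ((card_le_univ _).trans_eq (Fintype.card_fin n))⟩
  obtain ⟨t, -, ht⟩ := exists_le_card_fiber_of_nsmul_le_card_of_maps_to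
    (s := A) (t := univ) (f := counts) (fun _ _ => mem_univ _) univ_nonempty
    (b := (#A : ℝ) / (n + 1) ^ Fintype.card 𝒳) (by
      rw [nsmul_eq_mul, card_univ, Fintype.card_fun, Fintype.card_fin]
      push_cast
      exact (mul_div_cancel₀ _ (by positivity)).le)
  have hpos : 0 < #{v ∈ A | counts v = t} := by
    have : (0 : ℝ) < (#A : ℝ) / (n + 1) ^ Fintype.card 𝒳 := by
      have := hA.card_pos
      positivity
    exact_mod_cast this.trans_le ht
  obtain ⟨v₀, hv₀⟩ := card_pos.1 hpos
  obtain ⟨hv₀A, hv₀t⟩ := mem_filter.1 hv₀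
  refine ⟨v₀, hv₀A, ht.trans ?_⟩
  refine Nat.cast_le.2 (card_le_card fun v hv => ?_)
  obtain ⟨hvA, hvt⟩ := mem_filter.1 hv
  refine mem_filter.2 ⟨hvA, funext fun a => ?_⟩
  have : (counts v a : ℕ) = counts v₀ a := by rw [hvt, hv₀t]
  unfold empirical
  rw [show #{i | x v i = a} = #{i | x v₀ i = a} from this]

lemma exists_row_card_ge {α β : Type} [Fintype α] [Fintype β] [Nonempty α]
    (A : Finset (α × β)) {c : ℝ} (h : c * (Fintype.card α * Fintype.card β) ≤ #A) :
    ∃ a, c * Fintype.card β ≤ #{b | (a, b) ∈ A} := by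
  obtain ⟨a, -, ha⟩ := exists_le_card_fiber_of_nsmul_le_card_of_maps_to
    (s := A) (t := univ) (f := Prod.fst) (fun _ _ => mem_univ _) univ_nonempty
    (b := c * Fintype.card β) (by rw [nsmul_eq_mul, card_univ]; linarith)
  refine ⟨a, ha.trans (Nat.cast_le.2 ?_)⟩
  refine card_le_card_of_injOn Prod.snd (fun v hv => ?_) fun v hv w hw hvw => ?_
  · obtain ⟨h1, rfl⟩ := mem_filter.1 (mem_coe.1 hv)
    simpa using h1
  · exact Prod.ext ((mem_filter.1 (mem_coe.1 hv)).2.trans (mem_filter.1 (mem_coe.1 hw)).2.symm) hvw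

lemma exists_col_card_ge {α β : Type} [Fintype α] [Fintype β] [Nonempty β]
    (A : Finset (α × β)) {c : ℝ} (h : c * (Fintype.card α * Fintype.card β) ≤ #A) :
    ∃ b, c * Fintype.card α ≤ #{a | (a, b) ∈ A} := by
  obtain ⟨b, hb⟩ := exists_row_card_ge (A.map (Equiv.prodComm α β).toEmbedding) (c := c)
    (by rw [card_map]; linarith)
  exact ⟨b, by simpa using hb⟩

end Counting

section Rates

lemma prodProb_not [Fintype 𝒴₁] [Fintype 𝒴₂] (W : 𝒳 → PMF (𝒴₁ × 𝒴₂)) {n : ℕ} (x : Fin n → 𝒳)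
    (E : (Fin n → 𝒴₁ × 𝒴₂) → Prop) :
    prodProb W x E = 1 - prodProb W x fun y => ¬ E y := by
  have := sum_prod_eq_one (p := fun i y => (W (x i) y).toReal) fun i => sum_toReal_pmf (W (x i))
  rw [← sum_filter_add_sum_filter_not _ E] at this
  rw [eq_sub_iff_add_eq]
  unfold prodProb
  convert this

lemma prodProb_nonneg [Fintype 𝒴₁] [Fintype 𝒴₂] (W : 𝒳 → PMF (𝒴₁ × 𝒴₂)) {n : ℕ}
    (x : Fin n → 𝒳) (E : (Fin n → 𝒴₁ × 𝒴₂) → Prop) : 0 ≤ prodProb W x E :=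
  sum_nonneg fun _ _ => prod_nonneg fun _ _ => ENNReal.toReal_nonneg

lemma err₁_eq [Fintype 𝒴₁] [Fintype 𝒴₂] (W : 𝒳 → PMF (𝒴₁ × 𝒴₂)) {M₁ M₂ n : ℕ}
    (c : Code 𝒳 𝒴₁ 𝒴₂ M₁ M₂ n) (v : Fin M₁ × Fin M₂) :
    err₁ W c v = 1 - ∑ y with c.dec₁ (y, v.1) = some v.2,
      ∏ i, margChannel W Prod.fst (c.enc v i) (y i) := by
  rw [err₁, prodProb_not, sub_right_inj]
  simp only [ne_eq, not_not]
  unfold prodProb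
  convert sum_prod_fiber W Prod.fst (c.enc v) fun y => c.dec₁ (y, v.1) = some v.2

lemma err₂_eq [Fintype 𝒴₁] [Fintype 𝒴₂] (W : 𝒳 → PMF (𝒴₁ × 𝒴₂)) {M₁ M₂ n : ℕ}
    (c : Code 𝒳 𝒴₁ 𝒴₂ M₁ M₂ n) (v : Fin M₁ × Fin M₂) :
    err₂ W c v = 1 - ∑ y with c.dec₂ (y, v.2) = some v.1,
      ∏ i, margChannel W Prod.snd (c.enc v i) (y i) := by
  rw [err₂, prodProb_not, sub_right_inj]
  simp only [ne_eq, not_not]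
  unfold prodProb
  convert sum_prod_fiber W Prod.snd (c.enc v) fun y => c.dec₂ (y, v.2) = some v.1

lemma log_div_le_of_card_le {M n k : ℕ} (hM : 1 ≤ M) (hn : 0 < n) {η I s δ : ℝ} (hη : 0 < η)
    (hs : η / (n + 1) ^ k * M ≤ s) (h : s * (η / 2) ≤ Real.exp (n * (I + δ)))
    (hlarge : (k * Real.log (n + 1) + Real.log (2 / η ^ 2)) / n ≤ δ) :
    Real.log M / n ≤ I + 2 * δ := by
  have hn' : (0 : ℝ) < n := by positivity
  have hM' : (0 : ℝ) < M := by positivity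
  have hle : (M : ℝ) ≤ (n + 1) ^ k * (2 / η ^ 2) * Real.exp (n * (I + δ)) := by
    have h1 : η / (n + 1) ^ k * M * (η / 2) ≤ Real.exp (n * (I + δ)) :=
      (mul_le_mul_of_nonneg_right hs (by positivity)).trans h
    calc (M : ℝ) = (n + 1) ^ k * (2 / η ^ 2) * (η / (n + 1) ^ k * M * (η / 2)) := by field_simp
      _ ≤ _ := by gcongr
  have hlog := Real.log_le_log hM' hle
  rw [Real.log_mul (by positivity) (by positivity), Real.log_mul (by positivity) (by positivity),
    Real.log_pow, Real.log_exp] at hlog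
  rw [div_le_iff₀ hn'] at hlarge ⊢
  linarith

lemma eventually_log_div_le (k C : ℝ) {δ : ℝ} (hδ : 0 < δ) :
    ∀ᶠ n : ℕ in Filter.atTop, (k * Real.log (n + 1) + C) / n ≤ δ := by
  have h1 : (fun n : ℕ => k * Real.log ((n : ℝ) + 1) + C) =o[Filter.atTop] fun n : ℕ => (n : ℝ) := by
    have hlog : (fun n : ℕ => Real.log ((n : ℝ) + 1)) =o[Filter.atTop] fun n : ℕ => (n : ℝ) := by
      have ht : Filter.Tendsto (fun n : ℕ => (n : ℝ) + 1) Filter.atTop Filter.atTop :=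
        Filter.tendsto_atTop_add_const_right _ _ tendsto_natCast_atTop_atTop
      refine (Real.isLittleO_log_id_atTop.comp_tendsto ht).trans_isBigO ?_
      refine Asymptotics.IsBigO.of_bound 2 ?_
      filter_upwards [Filter.eventually_ge_atTop 1] with n hn
      have : (1 : ℝ) ≤ n := by exact_mod_cast hn
      simp only [Function.comp, id, Real.norm_eq_abs]
      rw [abs_of_nonneg (by positivity), abs_of_nonneg (by positivity)]
      linarith
    refine (hlog.const_mul_left k).add ?_
    exact Asymptotics.isLittleO_const_left.2 <| Or.inr <|
      Filter.tendsto_abs_atTop_atTop.comp tendsto_natCast_atTop_atTop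
  exact (h1.tendsto_div_nhds_zero.eventually (ge_mem_nhds hδ))

end Rates

/-- A good code for both receivers whose blocklength is large forces a common input
distribution with large mutual informations. -/
lemma exists_mem_stdSimplex_of_code [Fintype 𝒳] [Fintype 𝒴₁] [Fintype 𝒴₂]
    (W : 𝒳 → PMF (𝒴₁ × 𝒴₂)) {M₁ M₂ n : ℕ} (c : Code 𝒳 𝒴₁ 𝒴₂ M₁ M₂ n) (hn : 0 < n)
    (hM₁ : 1 ≤ M₁) (hM₂ : 1 ≤ M₂) {ε₁ ε₂ η δ : ℝ} (hε₁ : 0 ≤ ε₁) (hε₂ : 0 ≤ ε₂)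
    (hε : ε₁ + ε₂ < 1) (hη : η = (1 - (ε₁ + ε₂)) / 2) (hδ : 0 < δ)
    (h₁ : avgErr₁ W c ≤ ε₁) (h₂ : avgErr₂ W c ≤ ε₂)
    (hl₁ : 16 * Fintype.card 𝒴₁ / (n * δ ^ 2) ≤ η / 2)
    (hl₂ : 16 * Fintype.card 𝒴₂ / (n * δ ^ 2) ≤ η / 2)
    (hl : (Fintype.card 𝒳 * Real.log (n + 1) + Real.log (2 / η ^ 2)) / n ≤ δ) :
    ∃ P ∈ stdSimplex ℝ 𝒳,
      Real.log M₁ / n ≤ mutualInfo P (margChannel W Prod.snd) + 2 * δ ∧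
      Real.log M₂ / n ≤ mutualInfo P (margChannel W Prod.fst) + 2 * δ := by
  have : Nonempty (Fin M₁) := ⟨⟨0, hM₁⟩⟩
  have : Nonempty (Fin M₂) := ⟨⟨0, hM₂⟩⟩
  have hη0 : 0 < η := by linarith
  have hM : (0 : ℝ) < M₁ * M₂ := by positivity
  have hcard : (Fintype.card (Fin M₁ × Fin M₂) : ℝ) = M₁ * M₂ := by simp
  have e₁ : ∀ v, 0 ≤ err₁ W c v := fun v => prodProb_nonneg _ _ _
  have e₂ : ∀ v, 0 ≤ err₂ W c v := fun v => prodProb_nonneg _ _ _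
  rw [avgErr₁, div_le_iff₀ hM] at h₁
  rw [avgErr₂, div_le_iff₀ hM] at h₂
  have hA := exists_card_ge_of_sum_le (fun v => err₁ W c v + err₂ W c v)
    (fun v => add_nonneg (e₁ v) (e₂ v)) (add_nonneg hε₁ hε₂) hε
    (by rw [sum_add_distrib, hcard]; linarith)
  rw [← hη, hcard] at hA
  set A : Finset (Fin M₁ × Fin M₂) := {v | err₁ W c v + err₂ W c v ≤ 1 - η}
  have hAne : A.Nonempty := by
    rw [← card_pos]
    exact_mod_cast (mul_pos hη0 hM).trans_le hA
  obtain ⟨v₀, -, hB⟩ := exists_empirical_eq_card_ge A c.enc hAne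
  set P := empirical (c.enc v₀)
  set B : Finset (Fin M₁ × Fin M₂) := {v ∈ A | empirical (c.enc v) = P}
  have hBcard : η / (n + 1) ^ Fintype.card 𝒳 *
      (Fintype.card (Fin M₁) * Fintype.card (Fin M₂)) ≤ #B := by
    refine le_trans ?_ hB
    rw [div_mul_eq_mul_div, Fintype.card_fin, Fintype.card_fin]
    gcongr
  have hBmem : ∀ v ∈ B, empirical (c.enc v) = P ∧ err₁ W c v ≤ 1 - η ∧ err₂ W c v ≤ 1 - η := by
    intro v hv
    obtain ⟨hvA, hvP⟩ := mem_filter.1 hv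
    have := (mem_filter.1 hvA).2
    exact ⟨hvP, by linarith [e₂ v], by linarith [e₁ v]⟩
  refine ⟨P, empirical_mem_stdSimplex hn _, ?_, ?_⟩
  · obtain ⟨w₂, hw₂⟩ := exists_col_card_ge B hBcard
    rw [Fintype.card_fin] at hw₂
    refine log_div_le_of_card_le hM₁ hn hη0 hw₂ ?_ hl
    refine card_le_of_constantComposition hn (margChannel_nonneg W Prod.snd)
      (sum_margChannel W Prod.snd) _ (fun w₁ => c.enc (w₁, w₂)) (fun w₁ hw₁ => ?_)
      (fun y => c.dec₂ (y, w₂)) hδ (fun w₁ hw₁ => ?_) hl₂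
    · exact (hBmem (w₁, w₂) (by simpa using hw₁)).1
    · have := (hBmem (w₁, w₂) (by simpa using hw₁)).2.2
      rw [err₂_eq, sub_le_sub_iff_left] at this
      convert this
  · obtain ⟨w₁, hw₁⟩ := exists_row_card_ge B hBcard
    rw [Fintype.card_fin] at hw₁
    refine log_div_le_of_card_le hM₂ hn hη0 hw₁ ?_ hl
    refine card_le_of_constantComposition hn (margChannel_nonneg W Prod.fst)
      (sum_margChannel W Prod.fst) _ (fun w₂ => c.enc (w₁, w₂)) (fun w₂ hw₂ => ?_)
      (fun y => c.dec₁ (y, w₁)) hδ (fun w₂ hw₂ => ?_) hl₁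
    · exact (hBmem (w₁, w₂) (by simpa using hw₂)).1
    · have := (hBmem (w₁, w₂) (by simpa using hw₂)).2.1
      rw [err₁_eq, sub_le_sub_iff_left] at this
      convert this

end Toolkit

/-- **Converse for the average error probability with small error parameters**: if
`ε₁ ∈ (0, 1/2)` and `ε₂ ∈ (0, 1/4)`, or `ε₁ ∈ (0, 1/4)` and `ε₂ ∈ (0, 1/2)`, then any
`[ε₁,ε₂]`-achievable rate pair with respect to the average error probability lies in
the information region `𝒞`. -/
theorem converseAverageError [Fintype 𝒳] [Nonempty 𝒳] [Fintype 𝒴₁] [Nonempty 𝒴₁]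
    [Fintype 𝒴₂] [Nonempty 𝒴₂]
    (W : 𝒳 → PMF (𝒴₁ × 𝒴₂)) (ε₁ ε₂ : ℝ)
    (hrange : (ε₁ ∈ Set.Ioo (0 : ℝ) (1/2) ∧ ε₂ ∈ Set.Ioo (0 : ℝ) (1/4)) ∨
              (ε₁ ∈ Set.Ioo (0 : ℝ) (1/4) ∧ ε₂ ∈ Set.Ioo (0 : ℝ) (1/2)))
    (R₂ R₁ : ℝ) (hR₂ : 0 ≤ R₂) (hR₁ : 0 ≤ R₁)
    (hach : ∀ δ : ℝ, 0 < δ → ∃ N : ℕ, ∀ n, N ≤ n →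
      ∃ (M₁ M₂ : ℕ) (c : Code 𝒳 𝒴₁ 𝒴₂ M₁ M₂ n),
        1 ≤ M₁ ∧ 1 ≤ M₂ ∧
        R₂ - δ ≤ Real.log M₁ / n ∧ R₁ - δ ≤ Real.log M₂ / n ∧
        avgErr₁ W c ≤ ε₁ ∧ avgErr₂ W c ≤ ε₂) :
    (R₂, R₁) ∈ infoRegion W := by
  obtain ⟨hε₁, hε₂, hε⟩ : 0 ≤ ε₁ ∧ 0 ≤ ε₂ ∧ ε₁ + ε₂ < 1 := by
    rcases hrange with ⟨⟨h1, h2⟩, h3, h4⟩ | ⟨⟨h1, h2⟩, h3, h4⟩ <;>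
      exact ⟨h1.le, h3.le, by linarith⟩
  obtain ⟨P, hP, h₂, h₁⟩ := exists_mem_stdSimplex_of_approx
    (continuous_mutualInfo (margChannel W Prod.snd))
    (continuous_mutualInfo (margChannel W Prod.fst)) (r := R₂) (s := R₁) (by
      intro δ hδ
      set η : ℝ := (1 - (ε₁ + ε₂)) / 2 with hη
      have hη0 : 0 < η := by linarith
      have hδ3 : 0 < δ / 3 := by positivity
      obtain ⟨N, hN⟩ := hach (δ / 3) hδ3
      have hvar : ∀ K : ℝ, ∀ᶠ n : ℕ in Filter.atTop, K / (n * (δ / 3) ^ 2) ≤ η / 2 := by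
        intro K
        have : Filter.Tendsto (fun n : ℕ => K / (n * (δ / 3) ^ 2)) Filter.atTop (nhds 0) :=
          (tendsto_natCast_atTop_atTop.atTop_mul_const (by positivity)).const_div_atTop K
        exact this.eventually (ge_mem_nhds (by positivity))
      obtain ⟨n, hnN, hn, hl₁, hl₂, hl⟩ := ((Filter.eventually_ge_atTop N).and
        ((Filter.eventually_gt_atTop 0).and ((hvar (16 * Fintype.card 𝒴₁)).and
        ((hvar (16 * Fintype.card 𝒴₂)).and
        (eventually_log_div_le (Fintype.card 𝒳) (Real.log (2 / η ^ 2)) hδ3))))).exists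
      obtain ⟨M₁, M₂, c, hM₁, hM₂, hr₂, hr₁, he₁, he₂⟩ := hN n hnN
      obtain ⟨P, hP, hP₂, hP₁⟩ := exists_mem_stdSimplex_of_code W c hn hM₁ hM₂ hε₁ hε₂ hε hη hδ3
        he₁ he₂ hl₁ hl₂ hl
      exact ⟨P, hP, by linarith, by linarith⟩)
  let q : PMF (Unit × 𝒳) := PMF.ofFintype (fun u => ENNReal.ofReal (P u.2)) (by
    rw [Fintype.sum_prod_type, Finset.univ_unique, Finset.sum_singleton,
      ← ENNReal.ofReal_sum_of_nonneg fun a _ => hP.1 a, hP.2, ENNReal.ofReal_one])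
  have hq : ∀ a, (q ((), a)).toReal = P a := fun a => ENNReal.toReal_ofReal (hP.1 a)
  refine ⟨hR₂, hR₁, Unit, inferInstance, q, ?_, ?_⟩
  · exact h₂.trans_eq (condMI_bind_eq_mutualInfo W Prod.snd q hq).symm
  · exact h₁.trans_eq (condMI_bind_eq_mutualInfo W Prod.fst q hq).symm

end BDBC
end
end

section
/- List-decoding version of Fano's inequality: let (Ω, μ) be a probability space, C a finite set, M ≥ 1 and L ≥ 1 natural numbers, W : Ω → Fin M and Z : Ω → C measurable random variables, and O : C → Finset (Fin M) a list decoder with |O(z)| ≤ L for every z ∈ C. Set τ := μ{ω : W ω ∉ O(Z ω)}. Then the conditional entropy (in nats) satisfies H[W | Z] ≤ (−τ · log τ − (1 − τ) · log(1 − τ)) + τ · log M + (1 − τ) · log L, with the convention 0 · log 0 = 0. -/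
open scoped BigOperators

noncomputable section

/-- Shannon entropy (in nats) of a finitely-valued random variable `X` on `(Ω, μ)`. -/
def rvEntropy {Ω S : Type*} [MeasurableSpace Ω] (μ : MeasureTheory.Measure Ω)
    [Fintype S] (X : Ω → S) : ℝ :=
  ∑ s : S, Real.negMulLog (μ (X ⁻¹' {s})).toReal

/-- Conditional Shannon entropy (in nats) `H[X | Z] = H[(X,Z)] - H[Z]`. -/
def rvCondEntropy {Ω S T : Type*} [MeasurableSpace Ω] (μ : MeasureTheory.Measure Ω)
    [Fintype S] [Fintype T] (X : Ω → S) (Z : Ω → T) : ℝ :=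
  rvEntropy μ (fun ω => (X ω, Z ω)) - rvEntropy μ Z

/-- Mutual information (in nats) `I[X : Y] = H[X] + H[Y] - H[(X,Y)]`. -/
def rvMutualInfo {Ω S T : Type*} [MeasurableSpace Ω] (μ : MeasureTheory.Measure Ω)
    [Fintype S] [Fintype T] (X : Ω → S) (Y : Ω → T) : ℝ :=
  rvEntropy μ X + rvEntropy μ Y - rvEntropy μ (fun ω => (X ω, Y ω))

/-- Pointwise form of Gibbs' inequality with a factored reference weight `q * c`. -/
lemma negMulLog_le_of_factored_weight {p q c : ℝ} (hp : 0 ≤ p) (hq : 0 ≤ q) (hc : 0 ≤ c)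
    (hpq : p ≤ q) (hpc : 0 < p → 0 < c) :
    Real.negMulLog p ≤ -(p * Real.log q) - p * Real.log c + (q * c - p) := by
  rcases hp.eq_or_lt with rfl | hp
  · simpa using mul_nonneg hq hc
  · have hq' : 0 < q := hp.trans_le hpq
    have hc' : 0 < c := hpc hp
    have h := Real.log_le_sub_one_of_pos (div_pos (mul_pos hq' hc') hp)
    rw [Real.log_div (mul_pos hq' hc').ne' hp.ne', Real.log_mul hq'.ne' hc'.ne'] at h
    have h' := mul_le_mul_of_nonneg_left h hp.le
    have e : p * (q * c / p - 1) = q * c - p := by field_simp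
    rw [e] at h'
    unfold Real.negMulLog
    linarith

/-- List-decoding Fano inequality for a finite joint mass function. -/
lemma list_fano_of_mass {S T : Type*} [Fintype S] [DecidableEq S] [Fintype T]
    (p : S → T → ℝ) (q : T → ℝ) (hp : ∀ s t, 0 ≤ p s t) (hq : ∀ t, q t = ∑ s, p s t)
    (hq1 : ∑ t, q t = 1) (L : ℕ) (hL : 1 ≤ L) (hS : 1 ≤ Fintype.card S)
    (O : T → Finset S) (hO : ∀ t, (O t).card ≤ L)
    (τ : ℝ) (hτ : τ = ∑ s, ∑ t, if s ∈ O t then 0 else p s t) :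
    ∑ s, ∑ t, Real.negMulLog (p s t) - ∑ t, Real.negMulLog (q t) ≤
      (-(τ * Real.log τ) - (1 - τ) * Real.log (1 - τ))
        + τ * Real.log (Fintype.card S) + (1 - τ) * Real.log L := by
  have hL0 : (0 : ℝ) < L := by exact_mod_cast hL
  have hM0 : (0 : ℝ) < Fintype.card S := by exact_mod_cast hS
  have hsum : ∑ s, ∑ t, p s t = 1 := by
    rw [Finset.sum_comm, ← hq1]
    exact Finset.sum_congr rfl fun t _ => (hq t).symm
  have hτ' : 1 - τ = ∑ s, ∑ t, if s ∈ O t then p s t else 0 := by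
    rw [hτ, ← hsum, ← Finset.sum_sub_distrib]
    refine Finset.sum_congr rfl fun s _ => ?_
    rw [← Finset.sum_sub_distrib]
    refine Finset.sum_congr rfl fun t _ => ?_
    split_ifs <;> simp
  have le_total : ∀ (f : S → T → ℝ), (∀ s t, 0 ≤ f s t) → ∀ s t, f s t ≤ ∑ s, ∑ t, f s t :=
    fun f hf s t =>
      (Finset.single_le_sum (fun t _ => hf s t) (Finset.mem_univ t)).trans
        (Finset.single_le_sum (f := fun s => ∑ t, f s t)
          (fun s _ => Finset.sum_nonneg fun t _ => hf s t) (Finset.mem_univ s))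
  have hmiss : ∀ s t, (if s ∈ O t then 0 else p s t) ≤ τ := by
    intro s t
    rw [hτ]
    exact le_total (fun s t => if s ∈ O t then 0 else p s t)
      (fun s t => by split_ifs <;> simp [hp]) s t
  have hhit : ∀ s t, (if s ∈ O t then p s t else 0) ≤ 1 - τ := by
    intro s t
    rw [hτ']
    exact le_total (fun s t => if s ∈ O t then p s t else 0)
      (fun s t => by split_ifs <;> simp [hp]) s t
  have hτ0 : 0 ≤ τ := by
    rw [hτ]
    exact Finset.sum_nonneg fun s _ => Finset.sum_nonneg fun t _ => by split_ifs <;> simp [hp]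
  have hτ1 : 0 ≤ 1 - τ := by
    rw [hτ']
    exact Finset.sum_nonneg fun s _ => Finset.sum_nonneg fun t _ => by split_ifs <;> simp [hp]
  have hq0 : ∀ t, 0 ≤ q t := fun t => by
    rw [hq]; exact Finset.sum_nonneg fun s _ => hp s t
  set a : ℝ := (1 - τ) / L with ha
  set b : ℝ := τ / Fintype.card S with hb
  have ha0 : 0 ≤ a := by positivity
  have hb0 : 0 ≤ b := by positivity
  have key : ∀ s t, Real.negMulLog (p s t) ≤
      -(p s t * Real.log (q t)) - p s t * Real.log (if s ∈ O t then a else b)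
        + (q t * (if s ∈ O t then a else b) - p s t) := by
    intro s t
    refine negMulLog_le_of_factored_weight (hp s t) (hq0 t) (by split_ifs <;> assumption) ?_ ?_
    · rw [hq]
      exact Finset.single_le_sum (f := fun s => p s t) (fun s _ => hp s t) (Finset.mem_univ s)
    · intro h
      have h1 := hmiss s t
      have h2 := hhit s t
      split_ifs at h1 h2 ⊢
      · exact div_pos (h.trans_le h2) hL0
      · exact div_pos (h.trans_le h1) hM0
  have hentropy : ∑ s, ∑ t, -(p s t * Real.log (q t)) = ∑ t, Real.negMulLog (q t) := by
    rw [Finset.sum_comm]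
    refine Finset.sum_congr rfl fun t _ => ?_
    rw [Finset.sum_neg_distrib, ← Finset.sum_mul, ← hq, Real.negMulLog, neg_mul]
  have hcross : ∑ s, ∑ t, p s t * Real.log (if s ∈ O t then a else b) =
      (1 - τ) * Real.log a + τ * Real.log b := by
    rw [hτ', hτ]
    simp only [Finset.sum_mul, ← Finset.sum_add_distrib]
    refine Finset.sum_congr rfl fun s _ => Finset.sum_congr rfl fun t _ => ?_
    split_ifs <;> simp
  have hweight : ∑ s, ∑ t, q t * (if s ∈ O t then a else b) ≤ 1 := by
    rw [Finset.sum_comm, ← hq1]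
    refine Finset.sum_le_sum fun t _ => ?_
    rw [← Finset.mul_sum]
    refine mul_le_of_le_one_right (hq0 t) ?_
    calc ∑ s, (if s ∈ O t then a else b)
        ≤ ∑ s, ((if s ∈ O t then a else 0) + b) := by
          refine Finset.sum_le_sum fun s _ => ?_
          split_ifs <;> simp [hb0]
      _ = (O t).card * a + Fintype.card S * b := by
          simp [Finset.sum_add_distrib, Finset.sum_ite_mem]
      _ ≤ L * a + Fintype.card S * b := by
          gcongr
          exact hO t
      _ = 1 := by
          rw [ha, hb]
          field_simp
          ring
  have htotal := Finset.sum_le_sum fun s (_ : s ∈ Finset.univ) =>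
    Finset.sum_le_sum fun t (_ : t ∈ Finset.univ) => key s t
  simp only [Finset.sum_add_distrib, Finset.sum_sub_distrib] at htotal
  rw [hentropy, hcross, hsum] at htotal
  have hloga : (1 - τ) * Real.log a = (1 - τ) * Real.log (1 - τ) - (1 - τ) * Real.log L := by
    rcases hτ1.eq_or_lt with h | h
    · simp [← h]
    · rw [ha, Real.log_div h.ne' hL0.ne', mul_sub]
  have hlogb : τ * Real.log b = τ * Real.log τ - τ * Real.log (Fintype.card S) := by
    rcases hτ0.eq_or_lt with h | h
    · simp [← h]
    · rw [hb, Real.log_div h.ne' hM0.ne', mul_sub]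
  linarith

/-- **List-decoding version of Fano's inequality**: if the list decoder `O` (with list
sizes at most `L`) misses `W` with probability `τ`, then
`H[W | Z] ≤ h(τ) + τ · log M + (1 − τ) · log L` in nats, where `h` is the binary
entropy. -/
theorem list_fano {Ω : Type*} [MeasurableSpace Ω]
    (μ : MeasureTheory.Measure Ω) [MeasureTheory.IsProbabilityMeasure μ]
    {C : Type*} [Fintype C]
    (M L : ℕ) (hM : 1 ≤ M) (hL : 1 ≤ L)
    (W : Ω → Fin M) (Z : Ω → C)
    (hW : ∀ w, MeasurableSet (W ⁻¹' {w}))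
    (hZ : ∀ z, MeasurableSet (Z ⁻¹' {z}))
    (O : C → Finset (Fin M)) (hO : ∀ z, (O z).card ≤ L)
    (τ : ℝ) (hτ : τ = (μ {ω | W ω ∉ O (Z ω)}).toReal) :
    rvCondEntropy μ W Z ≤
      (-(τ * Real.log τ) - (1 - τ) * Real.log (1 - τ))
        + τ * Real.log M + (1 - τ) * Real.log L := by
  classical
  have hWZ : ∀ x, MeasurableSet ((fun ω => (W ω, Z ω)) ⁻¹' {x}) := by
    rintro ⟨w, z⟩
    convert (hW w).inter (hZ z) using 1
    ext ω
    simp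
  have hfibre : ∀ s : Finset (Fin M × C),
      ∑ x ∈ s, (μ ((fun ω => (W ω, Z ω)) ⁻¹' {x})).toReal =
        (μ ((fun ω => (W ω, Z ω)) ⁻¹' s)).toReal := by
    intro s
    rw [← MeasureTheory.sum_measure_preimage_singleton s fun x _ => hWZ x,
      ENNReal.toReal_sum fun x _ => MeasureTheory.measure_ne_top μ _]
  have hmarginal : ∀ z, (μ (Z ⁻¹' {z})).toReal =
      ∑ w, (μ ((fun ω => (W ω, Z ω)) ⁻¹' {(w, z)})).toReal := by
    intro z
    have h := hfibre (Finset.univ ×ˢ {z})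
    rw [Finset.sum_product] at h
    simp only [Finset.sum_singleton] at h
    rw [h]
    congr 2
    ext ω
    simp [eq_comm]
  have htotal : ∑ z, (μ (Z ⁻¹' {z})).toReal = 1 := by
    rw [← ENNReal.toReal_sum fun z _ => MeasureTheory.measure_ne_top μ _,
      MeasureTheory.sum_measure_preimage_singleton Finset.univ fun z _ => hZ z]
    simp
  have hmiss : τ = ∑ w, ∑ z, if w ∈ O z then 0
      else (μ ((fun ω => (W ω, Z ω)) ⁻¹' {(w, z)})).toReal := by
    have h := hfibre (Finset.univ.filter fun x => x.1 ∉ O x.2)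
    rw [Finset.sum_filter, Fintype.sum_prod_type] at h
    simp only [ite_not] at h
    rw [h, hτ]
    congr 2
    ext ω
    simp
  have h := list_fano_of_mass (fun w z => (μ ((fun ω => (W ω, Z ω)) ⁻¹' {(w, z)})).toReal)
    (fun z => (μ (Z ⁻¹' {z})).toReal) (fun _ _ => ENNReal.toReal_nonneg) hmarginal htotal
    L hL (by simpa using hM) O hO τ hmiss
  rw [Fintype.card_fin] at h
  unfold rvCondEntropy rvEntropy
  rw [Fintype.sum_prod_type]
  exact h
end
end

section
/- Existence of a large product-structured subcode with small maximum error: let W₁, W₂ be nonempty finite sets, ε > 0, and let λ₁, λ₂ : W₁ × W₂ → ℝ be nonnegative functions whose averages over W₁ × W₂ are each strictly less than ε. Then there exist a subset Q₁ ⊆ W₁ with |Q₁| ≥ |W₁| / 2 and, for each w₁ ∈ Q₁, a subset S(w₁) ⊆ W₂ with |S(w₁)| ≥ |W₂| / 2, such that λ₁(w₁, w₂) < 8ε and λ₂(w₁, w₂) < 8ε for every w₁ ∈ Q₁ and every w₂ ∈ S(w₁). -/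
open scoped BigOperators Classical

/-- **Markov's inequality at the median**: a nonnegative function whose average is less than
`c / 2` is less than `c` on at least half of its domain. -/
theorem half_card_le_card_filter_lt {α : Type*} [Fintype α] {f : α → ℝ} {c : ℝ}
    (hc : 0 < c) (hf : ∀ a, 0 ≤ f a) (hsum : ∑ a, f a < c / 2 * Fintype.card α) :
    (Fintype.card α : ℝ) / 2 ≤ (Finset.univ.filter fun a => f a < c).card := by
  have hbad : ((Finset.univ.filter fun a => ¬ f a < c).card : ℝ) * c ≤ ∑ a, f a := by
    rw [← nsmul_eq_mul]
    refine (Finset.card_nsmul_le_sum _ f c fun a ha => ?_).trans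
      (Finset.sum_le_sum_of_subset_of_nonneg (Finset.filter_subset _ _) fun a _ _ => hf a)
    exact not_lt.mp (Finset.mem_filter.mp ha).2
  have hsplit : ((Finset.univ.filter fun a => f a < c).card : ℝ) +
      (Finset.univ.filter fun a => ¬ f a < c).card = Fintype.card α := by
    exact_mod_cast Finset.card_filter_add_card_filter_not (s := Finset.univ) (fun a => f a < c)
  have hlt : ((Finset.univ.filter fun a => ¬ f a < c).card : ℝ) < Fintype.card α / 2 :=
    lt_of_mul_lt_mul_right (by linarith) hc.le
  linarith

/-- **Existence of a large product-structured subcode with small maximum error**: if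
the nonnegative error functions `l₁, l₂` on `W₁ × W₂` have averages strictly less than
`ε`, then there are at least `|W₁|/2` rows `w₁`, each with at least `|W₂|/2` columns
`w₂`, such that `l₁(w₁,w₂) < 8ε` and `l₂(w₁,w₂) < 8ε` on all these pairs. -/
theorem product_subcode {W₁ W₂ : Type*} [Fintype W₁] [Nonempty W₁]
    [Fintype W₂] [Nonempty W₂] (ε : ℝ) (hε : 0 < ε)
    (l₁ l₂ : W₁ × W₂ → ℝ) (h₁0 : ∀ v, 0 ≤ l₁ v) (h₂0 : ∀ v, 0 ≤ l₂ v)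
    (h₁ : (1 / ((Fintype.card W₁ : ℝ) * (Fintype.card W₂ : ℝ))) * ∑ v : W₁ × W₂, l₁ v < ε)
    (h₂ : (1 / ((Fintype.card W₁ : ℝ) * (Fintype.card W₂ : ℝ))) * ∑ v : W₁ × W₂, l₂ v < ε) :
    ∃ (Q₁ : Finset W₁) (S : W₁ → Finset W₂),
      (Q₁.card : ℝ) ≥ (Fintype.card W₁ : ℝ) / 2 ∧
      ∀ w₁ ∈ Q₁, ((S w₁).card : ℝ) ≥ (Fintype.card W₂ : ℝ) / 2 ∧
        ∀ w₂ ∈ S w₁, l₁ (w₁, w₂) < 8 * ε ∧ l₂ (w₁, w₂) < 8 * ε := by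
  have hM : (0 : ℝ) < Fintype.card W₁ := by exact_mod_cast Fintype.card_pos
  have hN : (0 : ℝ) < Fintype.card W₂ := by exact_mod_cast Fintype.card_pos
  rw [one_div_mul_eq_div, div_lt_iff₀ (by positivity)] at h₁ h₂
  have hl : ∀ v, 0 ≤ l₁ v + l₂ v := fun v => add_nonneg (h₁0 v) (h₂0 v)
  have htotal : ∑ w₁, ∑ w₂, (l₁ (w₁, w₂) + l₂ (w₁, w₂)) <
      4 * ε * Fintype.card W₂ / 2 * Fintype.card W₁ := by
    rw [← Fintype.sum_prod_type fun v => l₁ v + l₂ v, Finset.sum_add_distrib]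
    linarith
  refine ⟨Finset.univ.filter fun w₁ =>
      ∑ w₂, (l₁ (w₁, w₂) + l₂ (w₁, w₂)) < 4 * ε * Fintype.card W₂,
    fun w₁ => Finset.univ.filter fun w₂ => l₁ (w₁, w₂) + l₂ (w₁, w₂) < 8 * ε,
    half_card_le_card_filter_lt (by positivity)
      (fun w₁ => Finset.sum_nonneg fun w₂ _ => hl (w₁, w₂)) htotal,
    fun w₁ hw₁ => ⟨half_card_le_card_filter_lt (by positivity) (fun w₂ => hl (w₁, w₂)) ?_,
      fun w₂ hw₂ => ?_⟩⟩
  · have hrow := (Finset.mem_filter.mp hw₁).2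
    linarith
  · have hlt := (Finset.mem_filter.mp hw₂).2
    have hp := h₁0 (w₁, w₂)
    have hq := h₂0 (w₁, w₂)
    constructor <;> linarith
end

section
/- Parametrized subcode extraction from average to maximum error: let W₁, W₂ be nonempty finite sets, let ε₁, ε₂ ≥ 0 and f₁, f₂ > 0, set e₁ := ε₁/f₁ and e₂ := ε₂/f₂, and assume e₁ + 2e₂ < 1 and e₂ < 1. Let λ₁, λ₂ : W₁ × W₂ → ℝ be nonnegative functions whose averages over W₁ × W₂ are at most ε₁ and ε₂ respectively. Then there exist a subset T ⊆ W₁ with |T| ≥ ((1 − e₁ − 2e₂)/(1 − e₂)) · |W₁| and, for each w₁ ∈ T, a subset S(w₁) ⊆ W₂ with |S(w₁)| ≥ e₂ · |W₂|, such that λ₁(w₁, w₂) < f₁ and λ₂(w₁, w₂) < f₂ for every w₁ ∈ T and every w₂ ∈ S(w₁). -/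
open scoped BigOperators Classical

/-- **Markov's inequality** for two nonnegative functions on a finite type: all but
`(∑ l₁) / f₁ + (∑ l₂) / f₂` points satisfy both `l₁ < f₁` and `l₂ < f₂`. -/
theorem card_le_card_filter_lt_and_lt_add {α : Type*} [Fintype α] {f₁ f₂ : ℝ}
    (hf₁ : 0 < f₁) (hf₂ : 0 < f₂) {l₁ l₂ : α → ℝ} (h₁ : ∀ v, 0 ≤ l₁ v) (h₂ : ∀ v, 0 ≤ l₂ v) :
    (Fintype.card α : ℝ) ≤ ((Finset.univ.filter fun v => l₁ v < f₁ ∧ l₂ v < f₂).card : ℝ) +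
      (∑ v, l₁ v) / f₁ + (∑ v, l₂ v) / f₂ := by
  have h : ∑ _v : α, (1 : ℝ) ≤
      ∑ v, ((if l₁ v < f₁ ∧ l₂ v < f₂ then (1 : ℝ) else 0) + l₁ v / f₁ + l₂ v / f₂) := by
    refine Finset.sum_le_sum fun v _ => ?_
    have h₁' : 0 ≤ l₁ v / f₁ := div_nonneg (h₁ v) hf₁.le
    have h₂' : 0 ≤ l₂ v / f₂ := div_nonneg (h₂ v) hf₂.le
    split_ifs with hv
    · linarith
    · rcases not_and_or.mp hv with hv | hv
      · have := (one_le_div hf₁).mpr (not_lt.mp hv)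
        linarith
      · have := (one_le_div hf₂).mpr (not_lt.mp hv)
        linarith
  simpa [Finset.sum_add_distrib, ← Finset.sum_div] using h

/-- The total of a function bounded by `N` is at most a threshold `c` per index,
plus `N - c` for each index where the function reaches `c`. -/
theorem sum_le_card_mul_add_card_filter_mul {α : Type*} [Fintype α] {g : α → ℝ} {c N : ℝ}
    (hg : ∀ w, g w ≤ N) :
    ∑ w, g w ≤ Fintype.card α * c + (Finset.univ.filter fun w => c ≤ g w).card * (N - c) := by
  have h : ∑ w, g w ≤ ∑ w, (c + if c ≤ g w then N - c else 0) := by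
    refine Finset.sum_le_sum fun w _ => ?_
    split_ifs with hw
    · linarith [hg w]
    · linarith
  simpa [Finset.sum_add_distrib, ← Finset.sum_filter, mul_sub] using h

/-- **Parametrized subcode extraction from average to maximum error**: with
`e₁ = ε₁/f₁`, `e₂ = ε₂/f₂`, `e₁ + 2e₂ < 1` and `e₂ < 1`, from average error bounds
`ε₁, ε₂` one extracts a set `T` of rows of relative size at least
`(1 − e₁ − 2e₂)/(1 − e₂)` and, for each row in `T`, at least `e₂·|W₂|` columns on which
both maximum errors are below `f₁` and `f₂` respectively. -/
theorem parametrized_subcode {W₁ W₂ : Type*} [Fintype W₁] [Nonempty W₁]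
    [Fintype W₂] [Nonempty W₂]
    (ε₁ ε₂ f₁ f₂ : ℝ) (hε₁ : 0 ≤ ε₁) (hε₂ : 0 ≤ ε₂) (hf₁ : 0 < f₁) (hf₂ : 0 < f₂)
    (h1 : ε₁ / f₁ + 2 * (ε₂ / f₂) < 1) (h2 : ε₂ / f₂ < 1)
    (l₁ l₂ : W₁ × W₂ → ℝ) (h₁0 : ∀ v, 0 ≤ l₁ v) (h₂0 : ∀ v, 0 ≤ l₂ v)
    (h₁ : (1 / ((Fintype.card W₁ : ℝ) * (Fintype.card W₂ : ℝ))) * ∑ v : W₁ × W₂, l₁ v ≤ ε₁)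
    (h₂ : (1 / ((Fintype.card W₁ : ℝ) * (Fintype.card W₂ : ℝ))) * ∑ v : W₁ × W₂, l₂ v ≤ ε₂) :
    ∃ (T : Finset W₁) (S : W₁ → Finset W₂),
      (T.card : ℝ) ≥ ((1 - ε₁ / f₁ - 2 * (ε₂ / f₂)) / (1 - ε₂ / f₂)) * (Fintype.card W₁ : ℝ) ∧
      ∀ w₁ ∈ T, ((S w₁).card : ℝ) ≥ (ε₂ / f₂) * (Fintype.card W₂ : ℝ) ∧
        ∀ w₂ ∈ S w₁, l₁ (w₁, w₂) < f₁ ∧ l₂ (w₁, w₂) < f₂ := by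
  set M := (Fintype.card W₁ : ℝ) with hM
  set N := (Fintype.card W₂ : ℝ) with hN
  have hMN : 0 < M * N := by positivity
  have average_le {l : W₁ × W₂ → ℝ} {ε f : ℝ} (hf : 0 < f)
      (h : (1 / (M * N)) * ∑ v, l v ≤ ε) : (∑ v, l v) / f ≤ ε / f * (M * N) := by
    rw [one_div_mul_eq_div, div_le_iff₀ hMN] at h
    rw [div_mul_eq_mul_div]
    gcongr
  let S : W₁ → Finset W₂ := fun w₁ =>
    Finset.univ.filter fun w₂ => l₁ (w₁, w₂) < f₁ ∧ l₂ (w₁, w₂) < f₂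
  have hS : ((Finset.univ.filter fun v => l₁ v < f₁ ∧ l₂ v < f₂).card : ℝ) =
      ∑ w₁, ((S w₁).card : ℝ) := by
    simp only [S, Finset.card_filter, Nat.cast_sum, Fintype.sum_prod_type]
  have hgood := card_le_card_filter_lt_and_lt_add hf₁ hf₂ h₁0 h₂0
  rw [hS, Fintype.card_prod, Nat.cast_mul, ← hM, ← hN] at hgood
  have hrows := sum_le_card_mul_add_card_filter_mul (g := fun w₁ => ((S w₁).card : ℝ))
    (c := ε₂ / f₂ * N) (N := N) fun w₁ => Nat.cast_le.mpr (S w₁).card_le_univ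
  refine ⟨Finset.univ.filter fun w₁ => ε₂ / f₂ * N ≤ (S w₁).card, S, ?_, fun w₁ hw₁ =>
    ⟨(Finset.mem_filter.mp hw₁).2, fun w₂ hw₂ => (Finset.mem_filter.mp hw₂).2⟩⟩
  have hN0 : 0 < N := by positivity
  rw [ge_iff_le, div_mul_eq_mul_div, div_le_iff₀ (sub_pos.mpr h2)]
  refine le_of_mul_le_mul_right ?_ hN0
  linarith [average_le hf₁ h₁, average_le hf₂ h₂]
end

section
/- Sub-exponential growth of Hamming balls along sub-linear radii: let s ≥ 1 be a natural number and let l : ℕ → ℕ be a sequence with (l n)/n → 0 as n → ∞. Then (1/n) · log(∑_{k=0}^{l n} (n choose k) · (s − 1)^k) → 0 as n → ∞. (Consequently, for every n and every B ⊆ (Fin n → α) with |α| = s, the Hamming l n-neighborhood of B has cardinality at most |B| · e^{n δ_n} with δ_n → 0.) -/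
open scoped BigOperators

theorem sum_range_choose_mul_pow_le_one_add_pow (n l : ℕ) {x : ℝ} (hx : 0 ≤ x) :
    ∑ k ∈ Finset.range (l + 1), (n.choose k : ℝ) * x ^ k ≤ (1 + x) ^ n := by
  calc ∑ k ∈ Finset.range (l + 1), (n.choose k : ℝ) * x ^ k
      ≤ ∑ k ∈ Finset.range (n + l + 1), (n.choose k : ℝ) * x ^ k :=
        Finset.sum_le_sum_of_subset_of_nonneg (Finset.range_mono (by omega))
          fun k _ _ => by positivity
    _ = ∑ k ∈ Finset.range (n + 1), (n.choose k : ℝ) * x ^ k := by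
        refine (Finset.sum_subset (Finset.range_mono (by omega)) fun k _ hk => ?_).symm
        rw [Finset.mem_range, not_lt] at hk
        rw [Nat.choose_eq_zero_of_lt hk, Nat.cast_zero, zero_mul]
    _ = (1 + x) ^ n := by
        rw [add_comm 1 x, add_pow]
        exact Finset.sum_congr rfl fun k _ => by ring

theorem sum_range_choose_mul_pow_le (n l : ℕ) {q M : ℝ} (hq : 0 ≤ q) (hM : 1 ≤ M) :
    ∑ k ∈ Finset.range (l + 1), (n.choose k : ℝ) * q ^ k ≤ M ^ l * (1 + q / M) ^ n := by
  have hM0 : 0 < M := by linarith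
  calc ∑ k ∈ Finset.range (l + 1), (n.choose k : ℝ) * q ^ k
      ≤ ∑ k ∈ Finset.range (l + 1), M ^ l * ((n.choose k : ℝ) * (q / M) ^ k) := by
        refine Finset.sum_le_sum fun k hk => ?_
        have hkl : M ^ k ≤ M ^ l :=
          pow_le_pow_right₀ hM (Nat.lt_succ_iff.mp (Finset.mem_range.mp hk))
        calc (n.choose k : ℝ) * q ^ k = M ^ k * ((n.choose k : ℝ) * (q / M) ^ k) := by
              rw [mul_left_comm, ← mul_pow, mul_div_cancel₀ _ hM0.ne']
          _ ≤ _ := by gcongr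
    _ = M ^ l * ∑ k ∈ Finset.range (l + 1), (n.choose k : ℝ) * (q / M) ^ k := by
        rw [Finset.mul_sum]
    _ ≤ M ^ l * (1 + q / M) ^ n := by
        gcongr
        exact sum_range_choose_mul_pow_le_one_add_pow n l (by positivity)

theorem one_le_sum_range_choose_mul_pow (n l q : ℕ) :
    1 ≤ ∑ k ∈ Finset.range (l + 1), n.choose k * q ^ k := by
  simp [Finset.sum_range_succ']

theorem log_sum_range_choose_mul_pow_le (n l q : ℕ) {M : ℝ} (hM : 1 ≤ M) :
    Real.log ((∑ k ∈ Finset.range (l + 1), n.choose k * q ^ k : ℕ) : ℝ) ≤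
      l * Real.log M + n * (q / M) := by
  have hM0 : 0 < M := by linarith
  have hpos : (0 : ℝ) < ((∑ k ∈ Finset.range (l + 1), n.choose k * q ^ k : ℕ) : ℝ) := by
    exact_mod_cast one_le_sum_range_choose_mul_pow n l q
  have hle : ((∑ k ∈ Finset.range (l + 1), n.choose k * q ^ k : ℕ) : ℝ) ≤
      M ^ l * (1 + q / M) ^ n := by
    push_cast
    exact sum_range_choose_mul_pow_le n l q.cast_nonneg hM
  have hx : 0 < 1 + (q : ℝ) / M := by positivity
  refine (Real.log_le_log hpos hle).trans ?_
  rw [Real.log_mul (by positivity) (by positivity), Real.log_pow, Real.log_pow]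
  gcongr
  linarith [Real.log_le_sub_one_of_pos hx]

/-- **Sub-exponential growth of Hamming balls along sub-linear radii**: if
`(l n)/n → 0`, then `(1/n) · log(∑_{k=0}^{l n} (n choose k)(s−1)^k) → 0`, where the
sum bounds the cardinality of a Hamming ball of radius `l n` over an alphabet of
size `s ≥ 1`. -/
theorem hamming_ball_subexponential (s : ℕ) (hs : 1 ≤ s) (l : ℕ → ℕ)
    (hl : Filter.Tendsto (fun n => (l n : ℝ) / (n : ℝ)) Filter.atTop (nhds 0)) :
    Filter.Tendsto
      (fun n : ℕ => (1 / (n : ℝ)) *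
        Real.log ((∑ k ∈ Finset.range (l n + 1), n.choose k * (s - 1) ^ k : ℕ) : ℝ))
      Filter.atTop (nhds 0) := by
  rw [Metric.tendsto_nhds]
  intro ε hε
  obtain ⟨M, hM1, hM⟩ : ∃ M : ℝ, 1 ≤ M ∧ ((s - 1 : ℕ) : ℝ) / M < ε / 2 :=
    ((Filter.eventually_ge_atTop 1).and
      ((tendsto_const_nhds.div_atTop Filter.tendsto_id).eventually_lt_const
        (half_pos hε))).exists
  have hlM : Filter.Tendsto (fun n => (l n : ℝ) / (n : ℝ) * Real.log M) Filter.atTop (nhds 0) := by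
    simpa using hl.mul_const (Real.log M)
  filter_upwards [hlM.eventually_lt_const (half_pos hε), Filter.eventually_gt_atTop 0] with n hn hn0
  have hn0' : (0 : ℝ) < n := by exact_mod_cast hn0
  have hlog : 0 ≤
      Real.log ((∑ k ∈ Finset.range (l n + 1), n.choose k * (s - 1) ^ k : ℕ) : ℝ) :=
    Real.log_nonneg (by exact_mod_cast one_le_sum_range_choose_mul_pow n (l n) (s - 1))
  rw [Real.dist_0_eq_abs, abs_of_nonneg (by positivity)]
  calc _ ≤ 1 / (n : ℝ) * (l n * Real.log M + n * ((s - 1 : ℕ) / M)) := by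
        gcongr
        exact log_sum_range_choose_mul_pow_le n (l n) (s - 1) hM1
    _ = (l n : ℝ) / (n : ℝ) * Real.log M + ((s - 1 : ℕ) : ℝ) / M := by
        field_simp
    _ < ε := by linarith
end
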